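/- arXiv:2311.05140 — 5 statements merged into one kernel-verified Lean document; each statement's English description precedes it below -/
import Mathlib

section
/- Fix ρ>0 and A₀≥1. There exists a function A:(0,∞)→[1,∞), depending only on ρ and A₀, such that every length space (X,d) equipped with a (ρ,A₀)-locally doubling Borel measure μ is globally A-doubling: for every x∈X and every r>0 one has 0<μ(B_r(x))≤A(r)·μ(B_{r/2}(x))<∞. -/
open Set Metric Filter MeasureTheory ENNReal NNReal

noncomputable section

/-- The infimum of lengths (total variations) of continuous paths from `x` to `y`
with image contained in `S`: the induced length (extended) distance on `S`. -/
def lengthEDistIn {X : Type*} [PseudoEMetricSpace X] (S : Set X) (x y : X) : ℝ≥0∞ :=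
  ⨅ (γ : ℝ → X) (_ : ContinuousOn γ (Set.Icc 0 1)) (_ : γ 0 = x) (_ : γ 1 = y)
    (_ : Set.MapsTo γ (Set.Icc 0 1) S), eVariationOn γ (Set.Icc 0 1)

/-- A metric space is a length space if the distance between any two points is the
infimum of lengths of continuous paths joining them. -/
def IsLengthSpace (X : Type*) [MetricSpace X] : Prop :=
  ∀ x y : X, edist x y = lengthEDistIn (Set.univ : Set X) x y

/-- `(ρ, A₀)`-locally doubling Borel measure. -/
def LocallyDoubling {X : Type*} [MetricSpace X] [MeasurableSpace X]
    (μ : Measure X) (ρ : ℝ) (A₀ : ℝ≥0) : Prop :=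
  ∀ (x : X) (r : ℝ), 0 < r → r ≤ ρ →
    0 < μ (Metric.ball x r) ∧
    μ (Metric.ball x r) ≤ (A₀ : ℝ≥0∞) * μ (Metric.ball x (r / 2)) ∧
    (A₀ : ℝ≥0∞) * μ (Metric.ball x (r / 2)) < ⊤

theorem exists_split_of_isLengthSpace {X : Type*} [MetricSpace X] (hX : IsLengthSpace X)
    (x z : X) (a b : ℝ) (ha : 0 < a) (hb : 0 < b) (h : dist x z < a + b) :
    ∃ w, dist x w < a ∧ dist w z < b := by
  by_cases hxa : dist x z < a
  · exact ⟨z, hxa, by simpa using hb⟩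
  push Not at hxa
  have h1 : lengthEDistIn (Set.univ : Set X) x z < ENNReal.ofReal (a + b) := by
    rw [← hX x z, edist_dist]
    exact (ENNReal.ofReal_lt_ofReal_iff (by linarith)).2 h
  unfold lengthEDistIn at h1
  simp only [iInf_lt_iff] at h1
  obtain ⟨γ, hc, h0, h1', -, hv⟩ := h1
  have key : ∀ t ∈ Set.Icc (0 : ℝ) 1,
      dist x (γ t) + dist (γ t) z ≤ (eVariationOn γ (Set.Icc 0 1)).toReal := by
    intro t ht
    have e := eVariationOn.Icc_add_Icc γ (s := Set.univ) ht.1 ht.2 (Set.mem_univ t)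
    simp only [Set.univ_inter] at e
    have e1 : edist (γ 0) (γ t) ≤ eVariationOn γ (Set.Icc 0 t) :=
      eVariationOn.edist_le γ ⟨le_rfl, ht.1⟩ ⟨ht.1, le_rfl⟩
    have e2 : edist (γ t) (γ 1) ≤ eVariationOn γ (Set.Icc t 1) :=
      eVariationOn.edist_le γ ⟨le_rfl, ht.2⟩ ⟨ht.2, le_rfl⟩
    rw [h0] at e1
    rw [h1'] at e2
    have e3 := add_le_add e1 e2
    rw [e] at e3
    have e4 := ENNReal.toReal_mono hv.ne_top e3
    rwa [ENNReal.toReal_add (edist_ne_top _ _) (edist_ne_top _ _), ← dist_edist,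
      ← dist_edist] at e4
  have hV : (eVariationOn γ (Set.Icc 0 1)).toReal < a + b := by
    rwa [← ENNReal.lt_ofReal_iff_toReal_lt hv.ne_top]
  set V := (eVariationOn γ (Set.Icc 0 1)).toReal
  obtain ⟨c, hc1, hc2⟩ := exists_between (show max 0 (V - b) < a from max_lt ha (by linarith))
  have hc3 := le_max_left 0 (V - b)
  have hc4 := le_max_right 0 (V - b)
  have hcont : ContinuousOn (fun t => dist x (γ t)) (Set.Icc 0 1) :=
    (continuous_const.dist continuous_id).comp_continuousOn hc
  obtain ⟨t, ht, htc⟩ := intermediate_value_Icc (zero_le_one : (0 : ℝ) ≤ 1) hcont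
    (show c ∈ _ by
      simp only [h0, h1', dist_self]
      exact ⟨by linarith, by linarith⟩)
  have hk := key t ht
  simp only at htc
  exact ⟨γ t, by linarith, by linarith⟩

theorem growth_step {X : Type*} [MetricSpace X] [MeasurableSpace X] [BorelSpace X]
    (μ : Measure X) (hX : IsLengthSpace X) (A₀ : ℝ≥0) (s : ℝ) (hs : 0 < s)
    (hμ : LocallyDoubling μ (4 * s) A₀) (x : X) (r : ℝ) (hr : 2 * s ≤ r)
    (hfin : μ (Metric.ball x r) < ⊤) :
    μ (Metric.ball x (r + s)) ≤ (A₀ : ℝ≥0∞) ^ 2 * μ (Metric.ball x r) := by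
  obtain ⟨u, hut, hdis, hcov⟩ := Vitali.exists_disjoint_subfamily_covering_enlargement
    (fun a : X => Metric.ball a s) (Metric.ball x (r - s)) (fun _ => 1) 2 (by norm_num)
    (fun _ _ => zero_le_one) 1 (fun _ _ => le_rfl) (fun a _ => ⟨a, Metric.mem_ball_self hs⟩)
  have hsub : (⋃ i : u, Metric.ball (i : X) s) ⊆ Metric.ball x r := by
    refine Set.iUnion_subset fun i => Metric.ball_subset_ball' ?_
    have := Metric.mem_ball.1 (hut i.2)
    linarith
  have hpd : Pairwise (Function.onFun Disjoint fun i : u => Metric.ball (i : X) s) := by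
    intro i j hij
    exact hdis i.2 j.2 (fun h => hij (Subtype.ext h))
  have hle := measure_mono (μ := μ) hsub
  have hcount := Measure.countable_meas_pos_of_disjoint_of_meas_iUnion_ne_top μ
    (As := fun i : u => Metric.ball (i : X) s) (fun i => measurableSet_ball) hpd
    (hle.trans_lt hfin).ne
  have huniv : { i : u | 0 < μ (Metric.ball (i : X) s) } = Set.univ :=
    Set.eq_univ_of_forall fun i => (hμ i s hs (by linarith)).1
  rw [huniv, Set.countable_univ_iff] at hcount
  have hcover : Metric.ball x (r + s) ⊆ ⋃ i : u, Metric.ball (i : X) (4 * s) := by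
    intro z hz
    rw [Metric.mem_ball, dist_comm] at hz
    obtain ⟨w, hw1, hw2⟩ := exists_split_of_isLengthSpace hX x z (r - s) (2 * s)
      (by linarith) (by linarith) (by linarith)
    obtain ⟨e, heu, ⟨p, hp1, hp2⟩, -⟩ := hcov w (by rwa [Metric.mem_ball, dist_comm])
    refine Set.mem_iUnion.2 ⟨⟨e, heu⟩, ?_⟩
    rw [Metric.mem_ball] at hp1 hp2 ⊢
    have t1 := dist_triangle z w e
    have t2 := dist_triangle w p e
    rw [dist_comm] at hw2 hp1
    show dist z e < 4 * s
    linarith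
  have hdoub : ∀ e : X, μ (Metric.ball e (4 * s)) ≤ (A₀ : ℝ≥0∞) ^ 2 * μ (Metric.ball e s) := by
    intro e
    have d1 := (hμ e (4 * s) (by linarith) le_rfl).2.1
    have d2 := (hμ e (4 * s / 2) (by linarith) (by linarith)).2.1
    rw [show 4 * s / 2 / 2 = s by ring] at d2
    calc μ (Metric.ball e (4 * s)) ≤ _ := d1
      _ ≤ (A₀ : ℝ≥0∞) * ((A₀ : ℝ≥0∞) * μ (Metric.ball e s)) := by gcongr
      _ = _ := by rw [sq, mul_assoc]
  calc μ (Metric.ball x (r + s)) ≤ μ (⋃ i : u, Metric.ball (i : X) (4 * s)) := measure_mono hcover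
    _ ≤ ∑' i : u, μ (Metric.ball (i : X) (4 * s)) := measure_iUnion_le _
    _ ≤ ∑' i : u, (A₀ : ℝ≥0∞) ^ 2 * μ (Metric.ball (i : X) s) :=
      ENNReal.tsum_le_tsum fun i => hdoub i
    _ = (A₀ : ℝ≥0∞) ^ 2 * ∑' i : u, μ (Metric.ball (i : X) s) := ENNReal.tsum_mul_left
    _ ≤ (A₀ : ℝ≥0∞) ^ 2 * μ (⋃ i : u, Metric.ball (i : X) s) := by
      gcongr
      exact tsum_meas_le_meas_iUnion_of_disjoint μ (fun i => measurableSet_ball) hpd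
    _ ≤ _ := by gcongr

theorem growth_iter {X : Type*} [MetricSpace X] [MeasurableSpace X] [BorelSpace X]
    (μ : Measure X) (hX : IsLengthSpace X) (A₀ : ℝ≥0) (s : ℝ) (hs : 0 < s)
    (hμ : LocallyDoubling μ (4 * s) A₀) (x : X) (n : ℕ) :
    μ (Metric.ball x (2 * s + n * s)) < ⊤ ∧
    μ (Metric.ball x (2 * s + n * s)) ≤ (A₀ : ℝ≥0∞) ^ (2 * n) * μ (Metric.ball x (2 * s)) := by
  induction n with
  | zero =>
    have := hμ x (2 * s) (by linarith) (by linarith)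
    simpa using this.2.1.trans_lt this.2.2
  | succ n ih =>
    have hstep := growth_step μ hX A₀ s hs hμ x (2 * s + n * s)
      (by have : 0 ≤ (n : ℝ) * s := by positivity
          linarith) ih.1
    rw [show 2 * s + ((n + 1 : ℕ) : ℝ) * s = 2 * s + n * s + s by push_cast; ring]
    refine ⟨hstep.trans_lt (ENNReal.mul_lt_top (by simp) ih.1), hstep.trans ?_⟩
    calc _ ≤ (A₀ : ℝ≥0∞) ^ 2 * ((A₀ : ℝ≥0∞) ^ (2 * n) * μ (Metric.ball x (2 * s))) := by
          gcongr
          exact ih.2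
      _ = _ := by ring

/-- **Quantitative Hopf–Rinow theorem** (Theorem 2.1 of the paper): a uniform local
doubling property of a length metric measure space self-improves to a global doubling
property, with a function depending only on `ρ` and `A₀`. -/
theorem quantitative_hopf_rinow (ρ : ℝ) (hρ : 0 < ρ) (A₀ : ℝ≥0) (hA₀ : 1 ≤ A₀) :
    ∃ A : ℝ → ℝ≥0, (∀ r : ℝ, 0 < r → 1 ≤ A r) ∧
      ∀ (X : Type) [MetricSpace X] [MeasurableSpace X] [BorelSpace X]
        (μ : Measure X), IsLengthSpace X → LocallyDoubling μ ρ A₀ →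
        ∀ (x : X) (r : ℝ), 0 < r →
          0 < μ (Metric.ball x r) ∧
          μ (Metric.ball x r) ≤ (A r : ℝ≥0∞) * μ (Metric.ball x (r / 2)) ∧
          (A r : ℝ≥0∞) * μ (Metric.ball x (r / 2)) < ⊤ := by
  have hA : (1 : ℝ≥0∞) ≤ A₀ := by exact_mod_cast hA₀
  refine ⟨fun r => A₀ ^ (2 * ⌈r / (ρ / 4)⌉₊ + 1), fun r _ => one_le_pow₀ hA₀, ?_⟩
  intro X _ _ _ μ hX hμ x r hr
  have hs : 0 < ρ / 4 := by linarith
  have hμ' : LocallyDoubling μ (4 * (ρ / 4)) A₀ := by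
    rwa [show 4 * (ρ / 4) = ρ by ring]
  have hit := growth_iter μ hX A₀ (ρ / 4) hs hμ' x ⌈r / (ρ / 4)⌉₊
  have hsub : Metric.ball x r ⊆ Metric.ball x (2 * (ρ / 4) + ⌈r / (ρ / 4)⌉₊ * (ρ / 4)) := by
    apply Metric.ball_subset_ball
    have := (div_le_iff₀ hs).1 (Nat.le_ceil (r / (ρ / 4)))
    linarith
  have hfin : μ (Metric.ball x r) < ⊤ := (measure_mono hsub).trans_lt hit.1
  have hfin2 : μ (Metric.ball x (r / 2)) < ⊤ :=
    (measure_mono (Metric.ball_subset_ball (by linarith))).trans_lt hfin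
  refine ⟨?_, ?_, ENNReal.mul_lt_top ENNReal.coe_lt_top hfin2⟩
  · exact (hμ x (min r ρ) (lt_min hr hρ) (min_le_right _ _)).1.trans_le
      (measure_mono (Metric.ball_subset_ball (min_le_left _ _)))
  · rw [ENNReal.coe_pow]
    rcases le_or_gt r ρ with h | h
    · refine (hμ x r hr h).2.1.trans ?_
      gcongr
      exact le_self_pow₀ hA (by omega)
    · refine (measure_mono hsub).trans (hit.2.trans ?_)
      gcongr
      · omega
      · linarith
end
end

section
/- Fix ρ>0 and A₀≥1. For every R>0 and ε>0 there exists N(R,ε)∈ℕ, depending only on ρ, A₀, R, ε, with the following property: for every complete metric space (X,d) with basepoint p∈X which is a partial length space to p and which carries a (ρ,A₀)-locally doubling Borel measure μ, the closed ball of radius R around p can be covered by at most N(R,ε) open ε-balls. Consequently, every sequence of such pointed spaces (X_i,d_i,p_i) admits a subsequence converging in the pointed Gromov–Hausdorff topology. -/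
open Set Metric Filter MeasureTheory ENNReal NNReal

noncomputable section

/-- `(X, d)` is a partial length space to the point `p`: for every `x`, `d(p, x)` is
the infimum of lengths of continuous paths from `p` to `x`. -/
def IsPartialLengthSpaceTo {X : Type*} [MetricSpace X] (p : X) : Prop :=
  ∀ x : X, edist p x = lengthEDistIn (Set.univ : Set X) p x

theorem aux_doubling_iter {X : Type*} [MetricSpace X] [MeasurableSpace X]
    (μ : Measure X) (ρ : ℝ) (hρ : 0 < ρ) (A₀ : ℝ≥0) (h : LocallyDoubling μ ρ A₀)
    (x : X) (k : ℕ) :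
    μ (Metric.ball x ρ) ≤ (A₀ : ℝ≥0∞) ^ k * μ (Metric.ball x (ρ / 2 ^ k)) := by
  induction k with
  | zero => simp
  | succ k ih =>
    have h2 := (h x (ρ / 2 ^ k) (by positivity)
      (div_le_self hρ.le (one_le_pow₀ (by norm_num)))).2.1
    calc _ ≤ _ := ih
      _ ≤ (A₀ : ℝ≥0∞) ^ k * (A₀ * μ (Metric.ball x (ρ / 2 ^ k / 2))) := by gcongr
      _ = _ := by rw [pow_succ, mul_assoc, pow_succ, div_div]

theorem aux_sep_card {X : Type*} [MetricSpace X] [MeasurableSpace X] [BorelSpace X]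
    (μ : Measure X) (ρ : ℝ) (hρ : 0 < ρ) (A₀ : ℝ≥0) (h : LocallyDoubling μ ρ A₀)
    (x : X) (k : ℕ) (ε : ℝ) (hk1 : ρ / 2 ^ k ≤ ε / 2) (hk2 : ρ / 2 ^ k ≤ ρ / 4)
    (F : Finset X) (hF : ∀ y ∈ F, y ∈ Metric.ball x (ρ / 4))
    (hsep : ∀ y ∈ F, ∀ z ∈ F, y ≠ z → ε ≤ dist y z) :
    F.card ≤ ⌊A₀ ^ k⌋₊ := by
  have h0 := h x (ρ / 2) (by positivity) (by linarith)
  have hfin : μ (Metric.ball x (ρ / 2)) ≠ ⊤ := (lt_of_le_of_lt h0.2.1 h0.2.2).ne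
  have hsum : ∑ y ∈ F, μ (Metric.ball y (ρ / 2 ^ k)) ≤ μ (Metric.ball x (ρ / 2)) := by
    rw [← measure_biUnion_finset]
    · apply measure_mono
      refine Set.iUnion₂_subset fun y hy => ?_
      apply Metric.ball_subset_ball'
      have := Metric.mem_ball.1 (hF y hy)
      linarith
    · intro y hy z hz hyz
      apply Metric.ball_disjoint_ball
      have := hsep y hy z hz hyz
      linarith
    · intro y _
      exact measurableSet_ball
  have key : (F.card : ℝ≥0∞) * μ (Metric.ball x (ρ / 2))
      ≤ (A₀ : ℝ≥0∞) ^ k * μ (Metric.ball x (ρ / 2)) := by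
    calc (F.card : ℝ≥0∞) * μ (Metric.ball x (ρ / 2))
        = ∑ y ∈ F, μ (Metric.ball x (ρ / 2)) := by simp
      _ ≤ ∑ y ∈ F, (A₀ : ℝ≥0∞) ^ k * μ (Metric.ball y (ρ / 2 ^ k)) := by
          refine Finset.sum_le_sum fun y hy => ?_
          refine le_trans (measure_mono ?_) (aux_doubling_iter μ ρ hρ A₀ h y k)
          apply Metric.ball_subset_ball'
          have := Metric.mem_ball'.1 (hF y hy)
          linarith
      _ = (A₀ : ℝ≥0∞) ^ k * ∑ y ∈ F, μ (Metric.ball y (ρ / 2 ^ k)) := by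
          rw [Finset.mul_sum]
      _ ≤ _ := by gcongr
  have h3 := (ENNReal.mul_le_mul_iff_left h0.1.ne' hfin).1 key
  apply Nat.le_floor
  exact_mod_cast h3

theorem aux_greedy {X : Type*} [MetricSpace X] (S : Set X) (ε : ℝ) (hε : 0 < ε) (M : ℕ)
    (hM : ∀ F : Finset X, (∀ y ∈ F, y ∈ S) →
      (∀ y ∈ F, ∀ z ∈ F, y ≠ z → ε ≤ dist y z) → F.card ≤ M) :
    ∃ F : Finset X, F.card ≤ M ∧ S ⊆ ⋃ y ∈ F, Metric.ball y ε := by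
  classical
  by_contra hcon
  push Not at hcon
  have : ∀ n ≤ M + 1, ∃ F : Finset X, (∀ y ∈ F, y ∈ S) ∧
      (∀ y ∈ F, ∀ z ∈ F, y ≠ z → ε ≤ dist y z) ∧ F.card = n := by
    intro n
    induction n with
    | zero => intro _; exact ⟨∅, by simp⟩
    | succ n ih =>
      intro hn
      obtain ⟨F, hFS, hsep, hc⟩ := ih (by omega)
      obtain ⟨x, hxS, hx⟩ := Set.not_subset.1 (hcon F (by omega))
      have hx' : ∀ y ∈ F, ε ≤ dist x y := by
        intro y hy
        by_contra hlt
        exact hx (Set.mem_iUnion₂.2 ⟨y, hy, Metric.mem_ball.2 (not_le.1 hlt)⟩)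
      refine ⟨insert x F, ?_, ?_, ?_⟩
      · intro y hy
        rcases Finset.mem_insert.1 hy with rfl | hy
        · exact hxS
        · exact hFS y hy
      · intro y hy z hz hyz
        rcases Finset.mem_insert.1 hy with hy1 | hy1 <;>
          rcases Finset.mem_insert.1 hz with hz1 | hz1
        · exact absurd (hy1.trans hz1.symm) hyz
        · rw [hy1]; exact hx' z hz1
        · rw [hz1, dist_comm]; exact hx' y hy1
        · exact hsep y hy1 z hz1 hyz
      · rw [Finset.card_insert_of_notMem, hc]
        intro hxF
        have := hx' x hxF
        rw [dist_self] at this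
        linarith
  obtain ⟨F, h1, h2, h3⟩ := this (M + 1) le_rfl
  have := hM F h1 h2
  omega

theorem aux_path {X : Type*} [MetricSpace X] (p x : X) (hp : IsPartialLengthSpaceTo p)
    (R δ : ℝ) (hR : 0 ≤ R) (hδ : 0 < δ) (hx : R ≤ dist p x) :
    ∃ y, dist p y = R ∧ R + dist y x ≤ dist p x + δ := by
  have h1 : lengthEDistIn (Set.univ : Set X) p x < ENNReal.ofReal (dist p x + δ) := by
    rw [← hp x, edist_dist]
    exact (ENNReal.ofReal_lt_ofReal_iff (by positivity)).2 (by linarith)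
  simp only [lengthEDistIn, iInf_lt_iff] at h1
  obtain ⟨γ, hc, h0, h1', -, hlt⟩ := h1
  have hcd : ContinuousOn (fun t => dist p (γ t)) (Set.Icc 0 1) :=
    (continuous_const.dist continuous_id).comp_continuousOn hc
  obtain ⟨t, ht, hty⟩ := intermediate_value_Icc (zero_le_one' ℝ) hcd
    (show R ∈ Set.Icc _ _ by simp [h0, h1', hR, hx])
  simp only at hty
  refine ⟨γ t, hty, ?_⟩
  have h2 := eVariationOn.Icc_add_Icc γ (s := Set.Icc 0 1) ht.1 ht.2 ht
  have h3 : edist (γ 0) (γ t) ≤ eVariationOn γ (Set.Icc 0 1 ∩ Set.Icc 0 t) :=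
    eVariationOn.edist_le γ (by simp [ht.1]) ⟨ht, by simp [ht.1]⟩
  have h4 : edist (γ t) (γ 1) ≤ eVariationOn γ (Set.Icc 0 1 ∩ Set.Icc t 1) :=
    eVariationOn.edist_le γ ⟨ht, by simp [ht.2]⟩ (by simp [ht.2])
  have h5 : edist (γ 0) (γ t) + edist (γ t) (γ 1) ≤ ENNReal.ofReal (dist p x + δ) := by
    refine le_trans (add_le_add h3 h4) ?_
    rw [h2, Set.inter_self]
    exact hlt.le
  rw [h0, h1', edist_dist, edist_dist, ← ENNReal.ofReal_add dist_nonneg dist_nonneg,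
    ENNReal.ofReal_le_ofReal_iff (by positivity), hty] at h5
  exact h5

theorem aux_refine {X : Type*} [MetricSpace X] (S : Set X) (r ε : ℝ) (n M : ℕ)
    (hS : ∃ F : Finset X, F.card ≤ n ∧ S ⊆ ⋃ y ∈ F, Metric.ball y r)
    (hM : ∀ x : X, ∃ F : Finset X, F.card ≤ M ∧ Metric.ball x r ⊆ ⋃ y ∈ F, Metric.ball y ε) :
    ∃ F : Finset X, F.card ≤ n * M ∧ S ⊆ ⋃ y ∈ F, Metric.ball y ε := by
  classical
  obtain ⟨F, hF, hFS⟩ := hS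
  choose G hG hGS using hM
  refine ⟨F.biUnion G, (Finset.card_biUnion_le_card_mul _ _ M fun y _ => hG y).trans
    (Nat.mul_le_mul_right _ hF), ?_⟩
  intro x hx
  obtain ⟨y, hy, hxy⟩ := Set.mem_iUnion₂.1 (hFS hx)
  obtain ⟨z, hz, hxz⟩ := Set.mem_iUnion₂.1 (hGS y hxy)
  exact Set.mem_iUnion₂.2 ⟨z, Finset.mem_biUnion.2 ⟨y, hy, hz⟩, hxz⟩

theorem aux_exists_k (ρ : ℝ) (ε : ℝ) :
    ∃ k : ℕ, 0 < ρ → 0 < ε → ρ / 2 ^ k ≤ ε / 2 ∧ ρ / 2 ^ k ≤ ρ / 4 := by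
  by_cases h : 0 < ρ ∧ 0 < ε
  · obtain ⟨hρ, hε⟩ := h
    obtain ⟨k, hk⟩ := pow_unbounded_of_one_lt (max (2 * ρ / ε) 4) (one_lt_two (α := ℝ))
    refine ⟨k, fun _ _ => ⟨?_, ?_⟩⟩
    · have := (le_max_left _ _).trans hk.le
      rw [div_le_iff₀ hε] at this
      rw [div_le_iff₀ (by positivity)]
      linarith
    · have := (le_max_right _ _).trans hk.le
      exact div_le_div_of_nonneg_left hρ.le (by norm_num) this
  · exact ⟨0, fun a b => absurd ⟨a, b⟩ h⟩

/-- Precompactness of complete partial length spaces with `(ρ, A₀)`-locally doubling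
measures: a uniform bound, depending only on `ρ, A₀, R, ε`, on the number of open
`ε`-balls needed to cover the closed `R`-ball around the basepoint.  (By Gromov's
precompactness criterion this yields pointed Gromov–Hausdorff subconvergence of any
sequence of such spaces.) -/
theorem partialLength_locallyDoubling_uniformly_totallyBounded
    (ρ : ℝ) (hρ : 0 < ρ) (A₀ : ℝ≥0) (hA₀ : 1 ≤ A₀) :
    ∃ N : ℝ → ℝ → ℕ,
      ∀ (X : Type) [MetricSpace X] [CompleteSpace X] [MeasurableSpace X] [BorelSpace X]
        (μ : Measure X) (p : X),
        IsPartialLengthSpaceTo p → LocallyDoubling μ ρ A₀ →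
        ∀ R ε : ℝ, 0 < R → 0 < ε →
          ∃ F : Finset X, F.card ≤ N R ε ∧
            Metric.closedBall p R ⊆ ⋃ y ∈ F, Metric.ball y ε := by
  choose k hk using aux_exists_k ρ
  let M : ℝ → ℕ := fun ε => ⌊A₀ ^ (k ε)⌋₊
  refine ⟨fun R ε => M (ρ / 16) ^ ⌈R / (ρ / 8)⌉₊ * M ε, ?_⟩
  intro X _ _ _ _ μ p hp hμ R ε hR hε
  have hM : ∀ ε, 0 < ε → ∀ x : X, ∃ F : Finset X, F.card ≤ M ε ∧
      Metric.ball x (ρ / 4) ⊆ ⋃ y ∈ F, Metric.ball y ε := by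
    intro ε hε x
    refine aux_greedy _ ε hε _ fun F h1 h2 => ?_
    exact aux_sep_card μ ρ hρ A₀ hμ x (k ε) ε (hk ε hρ hε).1 (hk ε hρ hε).2 F h1 h2
  have hind : ∀ j : ℕ, ∃ F : Finset X, F.card ≤ M (ρ / 16) ^ j ∧
      Metric.closedBall p (j * (ρ / 8)) ⊆ ⋃ y ∈ F, Metric.ball y (ρ / 16) := by
    intro j
    induction j with
    | zero =>
      refine ⟨{p}, by simp, ?_⟩
      simp [hρ]
    | succ j ih =>
      rw [pow_succ]
      refine aux_refine _ (ρ / 4) _ _ _ ?_ (hM _ (by positivity))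
      obtain ⟨F, hF, hFS⟩ := ih
      refine ⟨F, hF, ?_⟩
      intro x hx
      rw [Metric.mem_closedBall'] at hx
      push_cast at hx
      have hy : ∃ y, dist p y ≤ j * (ρ / 8) ∧ dist y x ≤ ρ / 8 + ρ / 16 := by
        rcases le_total (dist p x) (j * (ρ / 8)) with h | h
        · exact ⟨x, h, by rw [dist_self]; positivity⟩
        · obtain ⟨y, h1, h2⟩ := aux_path p x hp (j * (ρ / 8)) (ρ / 16) (by positivity)
            (by positivity) h
          exact ⟨y, h1.le, by linarith⟩
      obtain ⟨y, h1, h2⟩ := hy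
      obtain ⟨z, hz, hyz⟩ := Set.mem_iUnion₂.1 (hFS (Metric.mem_closedBall'.2 h1))
      refine Set.mem_iUnion₂.2 ⟨z, hz, ?_⟩
      rw [Metric.mem_ball] at hyz ⊢
      have := dist_triangle x y z
      rw [dist_comm x y] at this
      linarith
  refine aux_refine _ (ρ / 4) _ _ _ ?_ (hM ε hε)
  obtain ⟨F, hF, hFS⟩ := hind ⌈R / (ρ / 8)⌉₊
  refine ⟨F, hF, ?_⟩
  have hR' : R ≤ ⌈R / (ρ / 8)⌉₊ * (ρ / 8) := by
    rw [← div_le_iff₀ (by positivity)]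
    exact Nat.le_ceil _
  refine (Metric.closedBall_subset_closedBall hR').trans (hFS.trans ?_)
  exact Set.iUnion₂_mono fun y _ => Metric.ball_subset_ball (by linarith)
end
end

section
/- Fix r₀,t₀>0, A₀≥1, and a positive function s(t) with s(t)→0 as t→0. Let 𝒟 be the family of all pointed metric spaces (W,d_W,p) where W is an (s(t),t₀)-undistorted domain in a length space (X,d) such that the closure of the r₀-neighborhood B_{r₀}(W,X)={z∈X : d(z,W)<r₀} in X is a complete metric space and X carries a Borel measure that is (r₀,A₀)-doubling along W, and p∈W. Then 𝒟 is uniformly totally bounded; equivalently, 𝒟 is precompact in the pointed Gromov–Hausdorff topology. -/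
open Set Metric Filter MeasureTheory ENNReal NNReal

noncomputable section

/-- A sequence is Cauchy with respect to the induced length metric of `S`. -/
def IsCauchyIn {X : Type*} [MetricSpace X] (S : Set X) (u : ℕ → X) : Prop :=
  ∀ ε : ℝ≥0∞, 0 < ε → ∃ N : ℕ, ∀ m ≥ N, ∀ n ≥ N, lengthEDistIn S (u m) (u n) < ε

/-- A sequence converges to `w` with respect to the induced length metric of `S`. -/
def ConvergesIn {X : Type*} [MetricSpace X] (S : Set X) (u : ℕ → X) (w : X) : Prop :=
  Filter.Tendsto (fun n => lengthEDistIn S (u n) w) Filter.atTop (nhds 0)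

/-- The `t`-interior `W_t° = {x ∈ W : d_W(x, ∂W) > t}` of `W`, where `∂W` is the
boundary of the topological interior `W°` in the metric completion of `(W, d_W)`,
expressed without forming the completion: `x ∈ W_t°` iff for some `r > t`, every
point of the completion at `d_W`-distance `< r` from `x` (i.e. every `d_W`-Cauchy
sequence in `W` eventually staying within `d_W`-distance `< r` of `x`) is the image of
a point of the interior `W°`. -/
def IntrinsicInterior {X : Type*} [MetricSpace X] (W : Set X) (t : ℝ) : Set X :=
  {x ∈ W | ∃ r : ℝ, t < r ∧ ∀ u : ℕ → X, (∀ n, u n ∈ W) → IsCauchyIn W u →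
    (∃ c : ℝ, c < r ∧ ∀ᶠ n in Filter.atTop, lengthEDistIn W x (u n) ≤ ENNReal.ofReal c) →
    ∃ w ∈ interior W, ConvergesIn W u w}

/-- A domain in a space: a connected subset whose topological interior has the same
closure as the set itself. -/
def IsDomainIn {X : Type*} [TopologicalSpace X] (W : Set X) : Prop :=
  IsConnected W ∧ closure (interior W) = closure W

/-- `W` is an `(s(t), t₀)`-undistorted domain: for every `0 < t ≤ t₀` the closure in
`(W, d_W)` of the `s(t)`-neighborhood of the `t`-interior `W_t°` contains all of `W`. -/
def UndistortedDomain {X : Type*} [MetricSpace X] (W : Set X) (s : ℝ → ℝ) (t₀ : ℝ) : Prop :=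
  ∀ t : ℝ, 0 < t → t ≤ t₀ →
    ∀ x ∈ W, ∀ ε : ℝ, 0 < ε → ∃ y ∈ W,
      lengthEDistIn W x y < ENNReal.ofReal ε ∧
      ∃ z ∈ IntrinsicInterior W t, lengthEDistIn W y z < ENNReal.ofReal (s t)

/-- The measure `μ` is `(r₀, A₀)`-doubling along `W`: the doubling condition holds for
all balls of radius `≤ r₀` centered in the open `r₀`-neighborhood of `W`. -/
def DoublingAlong {X : Type*} [MetricSpace X] [MeasurableSpace X]
    (μ : Measure X) (W : Set X) (r₀ : ℝ) (A₀ : ℝ≥0) : Prop :=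
  ∀ x : X, (∃ w ∈ W, dist x w < r₀) → ∀ r : ℝ, 0 < r → r ≤ r₀ →
    0 < μ (Metric.ball x r) ∧
    μ (Metric.ball x r) ≤ (A₀ : ℝ≥0∞) * μ (Metric.ball x (r / 2)) ∧
    (A₀ : ℝ≥0∞) * μ (Metric.ball x (r / 2)) < ⊤

section helpers

variable {X : Type*} [MetricSpace X]

lemma vAdd (γ : ℝ → X) {a b c : ℝ} (hab : a ≤ b) (hbc : b ≤ c) :
    eVariationOn γ (Icc a b) + eVariationOn γ (Icc b c) = eVariationOn γ (Icc a c) := by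
  have := eVariationOn.Icc_add_Icc γ (s := univ) hab hbc (mem_univ b)
  simpa using this

lemma led_le_path {S : Set X} {γ : ℝ → X} {a b : ℝ} (hab : a ≤ b)
    (hc : ContinuousOn γ (Icc a b)) (hm : MapsTo γ (Icc a b) S) :
    lengthEDistIn S (γ a) (γ b) ≤ eVariationOn γ (Icc a b) := by
  have hmap : MapsTo (fun u : ℝ => a + u * (b - a)) (Icc 0 1) (Icc a b) := by
    rintro u ⟨h0, h1⟩
    constructor <;> nlinarith
  have hmono : MonotoneOn (fun u : ℝ => a + u * (b - a)) (Icc 0 1) := by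
    intro u _ v _ huv
    have : 0 ≤ b - a := by linarith
    have := mul_le_mul_of_nonneg_right huv this
    simp only
    linarith
  refine le_trans ?_ (eVariationOn.comp_le_of_monotoneOn γ _ hmono hmap)
  unfold lengthEDistIn
  refine iInf_le_of_le (γ ∘ fun u : ℝ => a + u * (b - a)) ?_
  refine iInf_le_of_le (hc.comp (by fun_prop) hmap) ?_
  refine iInf_le_of_le (by simp) ?_
  refine iInf_le_of_le (by simp) ?_
  exact iInf_le_of_le (hm.comp hmap) le_rfl

lemma led_lt {S : Set X} {x y : X} {e : ℝ≥0∞} (h : lengthEDistIn S x y < e) :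
    ∃ γ : ℝ → X, ContinuousOn γ (Icc 0 1) ∧ γ 0 = x ∧ γ 1 = y ∧ MapsTo γ (Icc 0 1) S ∧
      eVariationOn γ (Icc 0 1) < e := by
  unfold lengthEDistIn at h
  simp only [iInf_lt_iff] at h
  obtain ⟨γ, h1, h2, h3, h4, h5⟩ := h
  exact ⟨γ, h1, h2, h3, h4, h5⟩

lemma led_self {S : Set X} {x : X} (hx : x ∈ S) : lengthEDistIn S x x = 0 := by
  have := led_le_path (S := S) (γ := fun _ : ℝ => x) (le_refl (0:ℝ)) (by fun_prop)
    (fun _ _ => hx)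
  rw [eVariationOn.subsingleton _ (by simp)] at this
  exact le_antisymm this bot_le

lemma edist_le_led {S : Set X} {x y : X} : edist x y ≤ lengthEDistIn S x y := by
  by_contra! h
  obtain ⟨γ, -, rfl, rfl, -, h5⟩ := led_lt h
  exact absurd (eVariationOn.edist_le γ (by simp) (by simp)) (not_le.2 h5)

lemma led_symm_le {S : Set X} {x y : X} : lengthEDistIn S x y ≤ lengthEDistIn S y x := by
  by_contra! h
  obtain ⟨γ, h1, h2, h3, h4, h5⟩ := led_lt h
  have hmap : MapsTo (fun u : ℝ => 1 - u) (Icc 0 1) (Icc 0 1) := by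
    rintro u ⟨h0, h1⟩
    constructor <;> linarith
  have h6 := led_le_path (S := S) (γ := γ ∘ fun u : ℝ => 1 - u) (zero_le_one)
    (h1.comp (by fun_prop) hmap) (h4.comp hmap)
  have h7 := eVariationOn.comp_le_of_antitoneOn γ (s := Icc 0 1) (t := Icc 0 1)
    (fun u : ℝ => 1 - u) (by intro u _ v _ huv; simp only; linarith) hmap
  simp only [Function.comp, sub_zero, sub_self, h2, h3] at h6
  exact absurd (h6.trans h7) (not_le.2 h5)

lemma led_symm {S : Set X} (x y : X) : lengthEDistIn S x y = lengthEDistIn S y x :=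
  le_antisymm led_symm_le led_symm_le

lemma led_triangle {S : Set X} (x y z : X) :
    lengthEDistIn S x z ≤ lengthEDistIn S x y + lengthEDistIn S y z := by
  refine ENNReal.le_of_forall_pos_le_add fun ε hε hfin => ?_
  have hxy : lengthEDistIn S x y ≠ ⊤ := fun h => by simp [h] at hfin
  have hyz : lengthEDistIn S y z ≠ ⊤ := fun h => by simp [h] at hfin
  have he : (ε / 2 : ℝ≥0∞) ≠ 0 := by
    simp [hε.ne']
  obtain ⟨γ, a1, a2, a3, a4, a5⟩ := led_lt (ENNReal.lt_add_right hxy he)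
  obtain ⟨δ, b1, b2, b3, b4, b5⟩ := led_lt (ENNReal.lt_add_right hyz he)
  set η : ℝ → X := fun u => if u ≤ 1 then γ u else δ (u - 1) with hη
  have hmap : MapsTo (fun u : ℝ => u - 1) (Icc 1 2) (Icc 0 1) := by
    rintro u ⟨h0, h1⟩
    constructor <;> linarith
  have e1 : EqOn η γ (Icc 0 1) := fun u hu => by simp [hη, hu.2]
  have e2 : EqOn η (δ ∘ fun u => u - 1) (Icc 1 2) := fun u hu => by
    by_cases h : u ≤ 1
    · have : u = 1 := le_antisymm h hu.1
      subst this
      simp [hη, a3, b2]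
    · simp [hη, h]
  have hun : Icc (0:ℝ) 2 = Icc 0 1 ∪ Icc 1 2 := by
    rw [Icc_union_Icc_eq_Icc] <;> norm_num
  have c1 : ContinuousOn η (Icc 0 1) := a1.congr e1
  have c2 : ContinuousOn η (Icc 1 2) := (b1.comp (by fun_prop) hmap).congr e2
  have c : ContinuousOn η (Icc 0 2) := by
    rw [hun]
    exact c1.union_of_isClosed c2 isClosed_Icc isClosed_Icc
  have m : MapsTo η (Icc 0 2) S := by
    rw [hun]
    rintro u (hu | hu)
    · rw [e1 hu]; exact a4 hu
    · rw [e2 hu]; exact b4 (hmap hu)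
  have key := led_le_path (by norm_num) c m
  rw [← vAdd η (by norm_num : (0:ℝ) ≤ 1) (by norm_num : (1:ℝ) ≤ 2),
    eVariationOn.eq_of_eqOn e1, eVariationOn.eq_of_eqOn e2] at key
  have v2 := eVariationOn.comp_le_of_monotoneOn δ (s := Icc 0 1) (t := Icc 1 2)
    (fun u : ℝ => u - 1) (by intro u _ v _ huv; simp only; linarith) hmap
  have h0 : η 0 = x := by simp [hη, a2]
  have h2 : η 2 = z := by
    have : (2:ℝ) - 1 = 1 := by norm_num
    simp [hη, this, b3]
  rw [h0, h2] at key
  calc lengthEDistIn S x z ≤ _ := key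
    _ ≤ (lengthEDistIn S x y + ε / 2) + (lengthEDistIn S y z + ε / 2) :=
      add_le_add a5.le (v2.trans b5.le)
    _ = lengthEDistIn S x y + lengthEDistIn S y z + ε := by
      rw [add_add_add_comm, ENNReal.add_halves]

lemma led_mid {S : Set X} {p x : X} (hp : p ∈ S) {a r : ℝ} (ha : 0 < a) (hr : 0 < r)
    (h : lengthEDistIn S p x < ENNReal.ofReal (a + r)) :
    ∃ q ∈ S, lengthEDistIn S p q < ENNReal.ofReal a ∧ dist q x ≤ r := by
  by_cases hd : dist p x ≤ r
  · exact ⟨p, hp, by rw [led_self hp]; simpa using ha, hd⟩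
  push Not at hd
  obtain ⟨γ, h1, h2, h3, h4, h5⟩ := led_lt h
  have hcont : ContinuousOn (fun u => dist (γ u) x) (Icc 0 1) := by fun_prop
  have hivt := intermediate_value_Icc' (zero_le_one) hcont
  obtain ⟨u, hu, hur⟩ := hivt (show r ∈ Icc (dist (γ 1) x) (dist (γ 0) x) by
    rw [h2, h3, dist_self]; exact ⟨hr.le, hd.le⟩)
  simp only at hur
  refine ⟨γ u, h4 hu, ?_, hur.le⟩
  have s1 : Icc 0 u ⊆ Icc (0:ℝ) 1 := Icc_subset_Icc_right hu.2
  have k := led_le_path hu.1 (h1.mono s1) (h4.mono_left s1)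
  rw [h2] at k
  refine lt_of_le_of_lt k ?_
  rw [← vAdd γ hu.1 hu.2] at h5
  have k2 : edist (γ u) (γ 1) ≤ eVariationOn γ (Icc u 1) :=
    eVariationOn.edist_le γ (by simp [hu.2]) (by simp [hu.2])
  rw [h3, edist_dist, hur] at k2
  rw [ENNReal.ofReal_add ha.le hr.le] at h5
  exact lt_of_add_lt_add_right (lt_of_le_of_lt (add_le_add le_rfl k2) h5)

lemma interior_of_ii {W : Set X} {t : ℝ} (ht : 0 < t) {z : X} (hz : z ∈ IntrinsicInterior W t) :
    z ∈ interior W := by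
  obtain ⟨hzW, r, htr, H⟩ := hz
  obtain ⟨w, hw, hc⟩ := H (fun _ => z) (fun _ => hzW)
    (fun ε hε => ⟨0, fun m _ n _ => by rw [led_self hzW]; exact hε⟩)
    ⟨0, by linarith, by simp [led_self hzW]⟩
  unfold ConvergesIn at hc
  have h0 : lengthEDistIn W z w = 0 := tendsto_nhds_unique tendsto_const_nhds hc
  have : edist z w = 0 := le_antisymm (h0 ▸ edist_le_led) bot_le
  rw [edist_eq_zero] at this
  exact this ▸ hw

lemma path_stays {W : Set X} {t : ℝ} (ht : 0 < t) {z : X} (hz : z ∈ IntrinsicInterior W t)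
    {γ : ℝ → X} (hc : ContinuousOn γ (Icc 0 1)) (h0 : γ 0 = z)
    (hV : eVariationOn γ (Icc 0 1) < ENNReal.ofReal t) :
    MapsTo γ (Icc 0 1) W := by
  have hzi := interior_of_ii ht hz
  by_contra hcon
  set B : Set ℝ := Icc 0 1 ∩ γ ⁻¹' (interior W)ᶜ with hB
  have hBc : IsCompact B := by
    refine isCompact_Icc.of_isClosed_subset ?_ inter_subset_left
    exact hc.preimage_isClosed_of_isClosed isClosed_Icc isOpen_interior.isClosed_compl
  have hBn : B.Nonempty := by
    by_contra hne
    rw [not_nonempty_iff_eq_empty] at hne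
    apply hcon
    intro u hu
    by_contra huW
    have : u ∈ B := ⟨hu, fun h => huW (interior_subset h)⟩
    rw [hne] at this
    exact this
  obtain ⟨τ, hτB, hτmin⟩ := hBc.exists_isLeast hBn
  have hτ0 : 0 < τ := by
    rcases hτB.1.1.eq_or_lt with h | h
    · exfalso
      apply hτB.2
      rw [← h, h0]
      exact hzi
    · exact h
  have hlt : ∀ σ, 0 ≤ σ → σ < τ → γ σ ∈ interior W := by
    intro σ h1 h2
    by_contra h
    exact absurd (hτmin ⟨⟨h1, h2.le.trans hτB.1.2⟩, h⟩) (not_le.2 h2)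
  set σ : ℕ → ℝ := fun n => τ * (1 - 1 / ((n:ℝ) + 1)) with hσ
  have hσ0 : ∀ n, 0 ≤ σ n := by
    intro n
    have : 1 / ((n:ℝ) + 1) ≤ 1 := by
      rw [div_le_one (by positivity)]
      have : (0:ℝ) ≤ n := by positivity
      linarith
    exact mul_nonneg hτ0.le (by linarith)
  have hσ1 : ∀ n, σ n < τ := by
    intro n
    have : 0 < 1 / ((n:ℝ) + 1) := by positivity
    have := mul_pos hτ0 this
    simp only [hσ]
    linarith
  have hσm : Monotone σ := by
    intro m n hmn
    have := Nat.one_div_le_one_div (α := ℝ) hmn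
    exact mul_le_mul_of_nonneg_left (by linarith) hτ0.le
  have hσt : Tendsto σ atTop (nhds τ) := by
    have := (tendsto_one_div_add_atTop_nhds_zero_nat (𝕜 := ℝ)).const_sub 1 |>.const_mul τ
    simpa [hσ] using this
  have hsub : ∀ {a b : ℝ}, 0 ≤ a → b < τ → Icc a b ⊆ Icc (0:ℝ) 1 := fun ha hb =>
    Icc_subset_Icc ha (hb.le.trans hτB.1.2)
  have hpath : ∀ {a b : ℝ}, 0 ≤ a → a ≤ b → b < τ →
      lengthEDistIn W (γ a) (γ b) ≤ eVariationOn γ (Icc a b) := fun ha hab hb =>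
    led_le_path hab (hc.mono (hsub ha hb)) fun u hu =>
      interior_subset (hlt u (ha.trans hu.1) (hu.2.trans_lt hb))
  have hVtop : eVariationOn γ (Icc 0 1) ≠ ⊤ := (hV.trans ENNReal.ofReal_lt_top).ne
  have hle : ∀ {a b : ℝ}, 0 ≤ a → b < τ → eVariationOn γ (Icc a b) ≤ eVariationOn γ (Icc 0 1) :=
    fun ha hb => eVariationOn.mono γ (hsub ha hb)
  set f : ℕ → ℝ := fun n => (eVariationOn γ (Icc 0 (σ n))).toReal with hf
  have hadd : ∀ m n, m ≤ n → eVariationOn γ (Icc (σ m) (σ n)) = ENNReal.ofReal (f n - f m) := by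
    intro m n hmn
    have := vAdd γ (hσ0 m) (hσm hmn)
    have t1 := ne_top_of_le_ne_top hVtop (hle le_rfl (hσ1 m))
    have t2 := ne_top_of_le_ne_top hVtop (hle (hσ0 m) (hσ1 n))
    simp only [hf]
    rw [← this, ENNReal.toReal_add t1 t2, add_sub_cancel_left, ENNReal.ofReal_toReal t2]
  have hfm : Monotone f := fun m n hmn => ENNReal.toReal_mono
    (ne_top_of_le_ne_top hVtop (hle le_rfl (hσ1 n)))
    (eVariationOn.mono γ (Icc_subset_Icc_right (hσm hmn)))
  have hfb : BddAbove (range f) := ⟨(eVariationOn γ (Icc 0 1)).toReal, by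
    rintro _ ⟨n, rfl⟩
    exact ENNReal.toReal_mono hVtop (hle le_rfl (hσ1 n))⟩
  have hfc : CauchySeq f := (tendsto_atTop_ciSup hfm hfb).cauchySeq
  obtain ⟨hzW, r, htr, H⟩ := hz
  obtain ⟨w, hw, hconv⟩ := H (fun n => γ (σ n))
    (fun n => interior_subset (hlt _ (hσ0 n) (hσ1 n))) (by
      intro ε hε
      obtain ⟨e, he0, he⟩ : ∃ e : ℝ, 0 < e ∧ ENNReal.ofReal e ≤ ε := by
        by_cases ht : ε = ⊤
        · exact ⟨1, one_pos, by simp [ht]⟩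
        · exact ⟨ε.toReal, ENNReal.toReal_pos hε.ne' ht, by rw [ENNReal.ofReal_toReal ht]⟩
      obtain ⟨N, hN⟩ := Metric.cauchySeq_iff.1 hfc e he0
      have main : ∀ m ≥ N, ∀ n ≥ N, m ≤ n → lengthEDistIn W (γ (σ m)) (γ (σ n)) < ε := by
        intro m hm n hn hmn
        refine lt_of_le_of_lt (hpath (hσ0 m) (hσm hmn) (hσ1 n)) ?_
        rw [hadd m n hmn]
        refine lt_of_lt_of_le ?_ he
        rw [ENNReal.ofReal_lt_ofReal_iff he0]
        have := hN n hn m hm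
        rw [Real.dist_eq] at this
        exact lt_of_le_of_lt (le_abs_self _) this
      refine ⟨N, fun m hm n hn => ?_⟩
      rcases le_total m n with h | h
      · exact main m hm n hn h
      · rw [led_symm]
        exact main n hn m hm h)
    ⟨(eVariationOn γ (Icc 0 1)).toReal, by
      have := (ENNReal.lt_ofReal_iff_toReal_lt hVtop).1 hV
      linarith, Eventually.of_forall fun n => by
        rw [ENNReal.ofReal_toReal hVtop, ← h0]
        exact (hpath le_rfl (hσ0 n) (hσ1 n)).trans (hle le_rfl (hσ1 n))⟩
  have l1 : Tendsto (fun n => γ (σ n)) atTop (nhds w) := by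
    rw [tendsto_iff_edist_tendsto_0]
    exact tendsto_of_tendsto_of_tendsto_of_le_of_le tendsto_const_nhds hconv
      (fun _ => bot_le) (fun _ => edist_le_led)
  have l2 : Tendsto (fun n => γ (σ n)) atTop (nhds (γ τ)) := by
    refine (hc τ hτB.1).tendsto.comp (tendsto_nhdsWithin_iff.2 ⟨hσt, Eventually.of_forall ?_⟩)
    exact fun n => ⟨hσ0 n, (hσ1 n).le.trans hτB.1.2⟩
  have := tendsto_nhds_unique l1 l2
  exact hτB.2 (this ▸ hw)

lemma led_lt_of_dist {W : Set X} (hX : IsLengthSpace X) {t : ℝ} (ht : 0 < t) {z y : X}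
    (hz : z ∈ IntrinsicInterior W t) {ρ : ℝ} (hρ : ρ ≤ t) (hd : dist z y < ρ) :
    lengthEDistIn W z y < ENNReal.ofReal ρ := by
  have h : edist z y < ENNReal.ofReal ρ := by
    rw [edist_dist]
    exact (ENNReal.ofReal_lt_ofReal_iff (dist_nonneg.trans_lt hd)).2 hd
  rw [hX z y] at h
  obtain ⟨γ, h1, h2, h3, h4, h5⟩ := led_lt h
  have m := path_stays ht hz h1 h2 (h5.trans_le (ENNReal.ofReal_le_ofReal hρ))
  have := led_le_path zero_le_one h1 m
  rw [h2, h3] at this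
  exact this.trans_lt h5

lemma exists_max_sep (P : X → X → Prop) (hrefl : ∀ x, P x x) (hsymm : ∀ x y, P x y → P y x)
    (S : Set X) (K : ℕ)
    (hK : ∀ G : Finset X, ↑G ⊆ S → (∀ x ∈ G, ∀ y ∈ G, x ≠ y → ¬ P x y) → G.card ≤ K) :
    ∃ F : Finset X, ↑F ⊆ S ∧ F.card ≤ K ∧ ∀ x ∈ S, ∃ y ∈ F, P x y := by
  classical
  set Q : ℕ → Prop := fun n => ∃ G : Finset X, ↑G ⊆ S ∧
    (∀ x ∈ G, ∀ y ∈ G, x ≠ y → ¬ P x y) ∧ G.card = n with hQ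
  have hQ0 : Q 0 := ⟨∅, by simp, by simp, by simp⟩
  obtain ⟨F, hFS, hFP, hFc⟩ := Nat.findGreatest_spec (P := Q) (Nat.zero_le K) hQ0
  refine ⟨F, hFS, hK F hFS hFP, fun x hx => ?_⟩
  by_contra! hno
  have hxF : x ∉ F := fun h => hno x h (hrefl x)
  have hS' : ↑(insert x F) ⊆ S := by
    intro y hy
    simp only [Finset.coe_insert, Set.mem_insert_iff] at hy
    rcases hy with rfl | hy
    · exact hx
    · exact hFS hy
  have hP' : ∀ a ∈ insert x F, ∀ b ∈ insert x F, a ≠ b → ¬ P a b := by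
    intro a ha b hb hab
    rw [Finset.mem_insert] at ha hb
    rcases ha with rfl | ha <;> rcases hb with rfl | hb
    · exact absurd rfl hab
    · exact hno b hb
    · exact fun h => hno a ha (hsymm _ _ h)
    · exact hFP a ha b hb hab
  have hQ1 : Q (insert x F).card := ⟨_, hS', hP', rfl⟩
  have := Nat.le_findGreatest (hK _ hS' hP') hQ1
  rw [Finset.card_insert_of_notMem hxF] at this
  omega

lemma count_le [MeasurableSpace X] [BorelSpace X] {μ : Measure X} {W : Set X} {r₀ : ℝ}
    {A₀ : ℝ≥0} (hr₀ : 0 < r₀) (hμ : DoublingAlong μ W r₀ A₀) {r ρ : ℝ} (hρ : 0 < ρ)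
    (hrρ : 2 * r + ρ ≤ r₀) (k : ℕ) (hk : r₀ / 2 ^ k ≤ ρ) (c : X) (G : Finset X)
    (hG : ↑G ⊆ W) (hGc : ∀ x ∈ G, dist x c < r)
    (hdisj : ∀ x ∈ G, ∀ y ∈ G, x ≠ y → Disjoint (ball x ρ) (ball y ρ)) :
    G.card ≤ ⌊A₀ ^ k⌋₊ := by
  rcases G.eq_empty_or_nonempty with rfl | ⟨x₁, hx₁⟩
  · simp
  have hdoub : ∀ x ∈ G, ∀ j : ℕ, μ (ball x r₀) ≤ (A₀ : ℝ≥0∞) ^ j * μ (ball x (r₀ / 2 ^ j)) := by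
    intro x hx j
    induction j with
    | zero => simp
    | succ j ih =>
      have hp : (1:ℝ) ≤ 2 ^ j := one_le_pow₀ (by norm_num)
      have := (hμ x ⟨x, hG hx, by simpa using hr₀⟩ (r₀ / 2 ^ j) (by positivity)
        (div_le_self hr₀.le hp)).2.1
      refine ih.trans ?_
      rw [pow_succ, mul_assoc]
      refine mul_le_mul_right (this.trans (le_of_eq ?_)) _
      rw [div_div, ← pow_succ]
  have hball : ∀ x ∈ G, ball c (r + ρ) ⊆ ball x r₀ := by
    intro x hx
    apply ball_subset_ball'
    have := hGc x hx
    rw [dist_comm] at this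
    linarith
  set M := μ (ball c (r + ρ)) with hM
  have hMtop : M ≠ ⊤ := by
    have h := hμ x₁ ⟨x₁, hG hx₁, by simpa using hr₀⟩ r₀ hr₀ le_rfl
    exact ((measure_mono (hball x₁ hx₁)).trans_lt (h.2.1.trans_lt h.2.2)).ne
  have hsub : ∀ x ∈ G, ball x ρ ⊆ ball c (r + ρ) := by
    intro x hx
    apply ball_subset_ball'
    linarith [hGc x hx]
  have hM0 : M ≠ 0 := by
    have hr : 0 < r := dist_nonneg.trans_lt (hGc x₁ hx₁)
    have h := hμ x₁ ⟨x₁, hG hx₁, by simpa using hr₀⟩ ρ hρ (by linarith)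
    exact (h.1.trans_le (measure_mono (hsub x₁ hx₁))).ne'
  have key : (G.card : ℝ≥0∞) * M ≤ (A₀ : ℝ≥0∞) ^ k * M := by
    calc (G.card : ℝ≥0∞) * M = ∑ x ∈ G, M := by simp
      _ ≤ ∑ x ∈ G, (A₀ : ℝ≥0∞) ^ k * μ (ball x ρ) := by
        refine Finset.sum_le_sum fun x hx => ?_
        refine (measure_mono (hball x hx)).trans ((hdoub x hx k).trans ?_)
        exact mul_le_mul_right (measure_mono (ball_subset_ball hk)) _
      _ = (A₀ : ℝ≥0∞) ^ k * μ (⋃ x ∈ G, ball x ρ) := by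
        rw [← Finset.mul_sum, measure_biUnion_finset (fun x hx y hy hxy => hdisj x hx y hy hxy)
          (fun _ _ => measurableSet_ball)]
      _ ≤ (A₀ : ℝ≥0∞) ^ k * M :=
        mul_le_mul_right (measure_mono (iUnion₂_subset hsub)) _
  rw [ENNReal.mul_le_mul_iff_left hM0 hMtop] at key
  apply Nat.le_floor
  exact_mod_cast key

lemma cover_W [MeasurableSpace X] [BorelSpace X] {μ : Measure X} {W : Set X} {r₀ : ℝ}
    {A₀ : ℝ≥0} (hr₀ : 0 < r₀) (hμ : DoublingAlong μ W r₀ A₀) {p : X} (hp : p ∈ W) (n : ℕ) :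
    ∃ C : Finset X, C.card ≤ ⌊A₀ ^ 4⌋₊ ^ n ∧ ∀ x ∈ W,
      lengthEDistIn W p x < ENNReal.ofReal ((n + 1) * (r₀ / 8)) → ∃ c ∈ C, dist x c < r₀ / 8 := by
  classical
  induction n with
  | zero =>
    refine ⟨{p}, by simp, fun x hx h => ⟨p, by simp, ?_⟩⟩
    have := edist_le_led.trans_lt h
    rw [edist_dist, ENNReal.ofReal_lt_ofReal_iff (by positivity)] at this
    rw [dist_comm]
    simpa using this
  | succ n ih =>
    obtain ⟨C, hC, hcov⟩ := ih
    have step : ∀ c : X, ∃ F : Finset X, ↑F ⊆ W ∩ {x | dist x c < 3 * (r₀ / 8)} ∧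
        F.card ≤ ⌊A₀ ^ 4⌋₊ ∧ ∀ x ∈ W ∩ {x | dist x c < 3 * (r₀ / 8)}, ∃ y ∈ F,
          dist x y < r₀ / 8 := by
      intro c
      refine exists_max_sep (fun x y => dist x y < r₀ / 8) (fun x => by simpa using hr₀)
        (fun x y h => by rwa [dist_comm]) _ _ ?_
      intro G hGS hGP
      refine count_le hr₀ hμ (r := 3 * (r₀ / 8)) (ρ := r₀ / 16) (by positivity) (by linarith) 4
        (le_of_eq (by norm_num)) c G
        (fun x hx => (hGS hx).1) (fun x hx => (hGS hx).2) ?_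
      intro x hx y hy hxy
      apply ball_disjoint_ball
      have := hGP x hx y hy hxy
      push Not at this
      linarith
    choose F _ hF2 hF3 using step
    refine ⟨C.biUnion F, ?_, ?_⟩
    · refine (Finset.card_biUnion_le_card_mul _ _ _ fun c _ => hF2 c).trans ?_
      rw [pow_succ]
      exact Nat.mul_le_mul_right _ hC
    · intro x hx h
      obtain ⟨q, hq, hq1, hq2⟩ := led_mid hp (a := (n + 1) * (r₀ / 8)) (r := r₀ / 8)
        (by positivity) (by positivity) (x := x) (by
          convert h using 2
          push_cast
          ring)
      obtain ⟨c, hc, hqc⟩ := hcov q hq hq1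
      have hxc : dist x c < 3 * (r₀ / 8) := by
        have := dist_triangle x q c
        rw [dist_comm x q] at this
        linarith
      obtain ⟨y, hy, hxy⟩ := hF3 c x ⟨hx, hxc⟩
      exact ⟨y, Finset.mem_biUnion.2 ⟨c, hc, hy⟩, hxy⟩

end helpers

/-- **Main Theorem 1** of the paper (metric-measure form): the family of pointed
`(s(t), t₀)`-undistorted domains `(W, d_W, p)` in length spaces, whose `r₀`-neighborhood
has complete closure and which carry a measure `(r₀, A₀)`-doubling along `W`, is
uniformly totally bounded, i.e. precompact in the pointed Gromov–Hausdorff topology. -/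
theorem undistorted_domains_uniformly_totallyBounded
    (r₀ t₀ : ℝ) (hr₀ : 0 < r₀) (ht₀ : 0 < t₀) (A₀ : ℝ≥0) (hA₀ : 1 ≤ A₀)
    (s : ℝ → ℝ) (hs_pos : ∀ t : ℝ, 0 < t → 0 < s t)
    (hs_lim : Filter.Tendsto s (nhdsWithin 0 (Set.Ioi 0)) (nhds 0)) :
    ∃ N : ℝ → ℝ → ℕ,
      ∀ (X : Type) [MetricSpace X] [MeasurableSpace X] [BorelSpace X]
        (μ : Measure X) (W : Set X) (p : X),
        IsLengthSpace X → IsDomainIn W → p ∈ W →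
        UndistortedDomain W s t₀ →
        IsComplete (closure {z : X | ∃ w ∈ W, dist z w < r₀}) →
        DoublingAlong μ W r₀ A₀ →
        ∀ R ε : ℝ, 0 < R → 0 < ε →
          ∃ F : Finset X, ↑F ⊆ W ∧ F.card ≤ N R ε ∧
            ∀ x ∈ W, lengthEDistIn W p x < ENNReal.ofReal R →
              ∃ y ∈ F, lengthEDistIn W x y < ENNReal.ofReal ε := by
  classical
  have main : ∀ R ε : ℝ, ∃ n : ℕ, 0 < R → 0 < ε →
      ∀ (X : Type) [MetricSpace X] [MeasurableSpace X] [BorelSpace X]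
        (μ : Measure X) (W : Set X) (p : X),
        IsLengthSpace X → p ∈ W →
        UndistortedDomain W s t₀ →
        DoublingAlong μ W r₀ A₀ →
          ∃ F : Finset X, ↑F ⊆ W ∧ F.card ≤ n ∧
            ∀ x ∈ W, lengthEDistIn W p x < ENNReal.ofReal R →
              ∃ y ∈ F, lengthEDistIn W x y < ENNReal.ofReal ε := by
    intro R ε
    by_cases hR : 0 < R
    swap
    · exact ⟨0, fun h => absurd h hR⟩
    by_cases hε : 0 < ε
    swap
    · exact ⟨0, fun _ h => absurd h hε⟩
    obtain ⟨t, ht, htt, hst⟩ : ∃ t : ℝ, 0 < t ∧ t ≤ t₀ ∧ s t < ε / 4 := by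
      have h1 : ∀ᶠ t in nhdsWithin (0:ℝ) (Set.Ioi 0), s t < ε / 4 :=
        hs_lim.eventually (gt_mem_nhds (by positivity))
      have h2 : ∀ᶠ t in nhdsWithin (0:ℝ) (Set.Ioi 0), t ∈ Set.Ioc 0 t₀ :=
        Ioc_mem_nhdsGT ht₀
      obtain ⟨t, h1, h2⟩ := (h1.and h2).exists
      exact ⟨t, h2.1, h2.2, h1⟩
    obtain ⟨ρ, hρ, hρt, hρε, hρr⟩ : ∃ ρ : ℝ, 0 < ρ ∧ ρ ≤ t ∧ ρ ≤ ε / 8 ∧ ρ ≤ r₀ / 8 :=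
      ⟨min t (min (ε / 8) (r₀ / 8)), by positivity, min_le_left _ _,
        (min_le_right _ _).trans (min_le_left _ _), (min_le_right _ _).trans (min_le_right _ _)⟩
    obtain ⟨k, hk⟩ : ∃ k : ℕ, r₀ / 2 ^ k ≤ ρ := by
      obtain ⟨k, hk⟩ := pow_unbounded_of_one_lt (r₀ / ρ) (by norm_num : (1:ℝ) < 2)
      refine ⟨k, ?_⟩
      rw [div_lt_iff₀ hρ] at hk
      rw [div_le_iff₀ (by positivity)]
      linarith
    obtain ⟨n, hn⟩ : ∃ n : ℕ, R + ε ≤ (n + 1) * (r₀ / 8) := by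
      obtain ⟨n, hn⟩ := exists_nat_ge ((R + ε) / (r₀ / 8))
      refine ⟨n, ?_⟩
      rw [div_le_iff₀ (by positivity)] at hn
      linarith
    refine ⟨⌊A₀ ^ 4⌋₊ ^ n * ⌊A₀ ^ k⌋₊, fun _ _ => ?_⟩
    intro X _ _ _ μ W p hX hp hU hμ
    obtain ⟨C, hC, hcov⟩ := cover_W hr₀ hμ hp n
    have hIW : ∀ {z}, z ∈ IntrinsicInterior W t → z ∈ W := fun h => h.1
    -- maximal separated set; off the interior we use the trivial relation
    obtain ⟨F, hFS, hFc, hF⟩ := exists_max_sep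
      (fun x y => x = y ∨ lengthEDistIn W x y < ENNReal.ofReal (2 * ρ)) (fun x => Or.inl rfl)
      (fun x y h => h.elim (fun h => Or.inl h.symm) (fun h => Or.inr (by rwa [led_symm])))
      {z | z ∈ IntrinsicInterior W t ∧ lengthEDistIn W p z < ENNReal.ofReal (R + ε)}
      (⌊A₀ ^ 4⌋₊ ^ n * ⌊A₀ ^ k⌋₊) (by
        intro G hGS hGP
        have hsub : G ⊆ C.biUnion fun c => G.filter fun x => dist x c < r₀ / 8 := by
          intro x hx
          obtain ⟨c, hc, hxc⟩ := hcov x (hIW (hGS hx).1)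
            ((hGS hx).2.trans_le (ENNReal.ofReal_le_ofReal hn))
          exact Finset.mem_biUnion.2 ⟨c, hc, Finset.mem_filter.2 ⟨hx, hxc⟩⟩
        refine (Finset.card_le_card hsub).trans ?_
        refine (Finset.card_biUnion_le_card_mul _ _ ⌊A₀ ^ k⌋₊ fun c _ => ?_).trans
          (Nat.mul_le_mul_right _ hC)
        refine count_le hr₀ hμ hρ (r := r₀ / 8) (by linarith) k hk c _ ?_ ?_ ?_
        · intro x hx
          exact hIW (hGS (Finset.mem_filter.1 hx).1).1
        · intro x hx
          exact (Finset.mem_filter.1 hx).2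
        · intro x hx y hy hxy
          have hx := (Finset.mem_filter.1 hx).1
          have hy := (Finset.mem_filter.1 hy).1
          rw [Set.disjoint_left]
          intro w hwx hwy
          rw [mem_ball, dist_comm] at hwx hwy
          have l1 := led_lt_of_dist hX ht (hGS hx).1 hρt hwx
          have l2 := led_lt_of_dist hX ht (hGS hy).1 hρt hwy
          rw [led_symm] at l2
          apply hGP x hx y hy hxy
          right
          refine (led_triangle x w y).trans_lt ?_
          rw [two_mul, ENNReal.ofReal_add hρ.le hρ.le]
          exact ENNReal.add_lt_add l1 l2)
    refine ⟨F, fun z hz => hIW (hFS hz).1, hFc, fun x hx hpx => ?_⟩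
    obtain ⟨y, hy, hxy, z, hz, hyz⟩ := hU t ht htt x hx (ε / 4) (by positivity)
    have hsz : lengthEDistIn W x z < ENNReal.ofReal (ε / 2) := by
      refine (led_triangle x y z).trans_lt ?_
      have : ε / 2 = ε / 4 + ε / 4 := by ring
      rw [this, ENNReal.ofReal_add (by positivity) (by positivity)]
      exact ENNReal.add_lt_add hxy (hyz.trans_le (ENNReal.ofReal_le_ofReal hst.le))
    have hpz : lengthEDistIn W p z < ENNReal.ofReal (R + ε) := by
      refine (led_triangle p x z).trans_lt ?_
      rw [ENNReal.ofReal_add hR.le hε.le]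
      exact ENNReal.add_lt_add hpx (hsz.trans_le (ENNReal.ofReal_le_ofReal (by linarith)))
    obtain ⟨w, hw, hzw⟩ := hF z ⟨hz, hpz⟩
    refine ⟨w, hw, ?_⟩
    rcases hzw with rfl | hzw
    · exact hsz.trans_le (ENNReal.ofReal_le_ofReal (by linarith))
    · refine (led_triangle x z w).trans_lt ?_
      have : ε = ε / 2 + ε / 2 := by ring
      rw [this, ENNReal.ofReal_add (by positivity) (by positivity)]
      exact ENNReal.add_lt_add hsz (hzw.trans_le (ENNReal.ofReal_le_ofReal (by linarith)))
  choose N hN using main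
  refine ⟨N, ?_⟩
  intro X _ _ _ μ W p hX _ hp hU _ hμ R ε hR hε
  exact hN R ε hR hε X μ W p hX hp hU hμ
end
end

section
/- Fix τ≥1, r₀,t₀>0, A₀≥1. There exists a nondecreasing function A:(0,∞)→[1,∞), depending only on τ, r₀, t₀, A₀, such that: whenever W is a (τt,t₀)-undistorted domain (of τ-Lipschitz type) in a length space (X,d) for which the closure of the r₀-neighborhood B_{r₀}(W,X) in X is complete and X carries a Borel measure μ that is (r₀,A₀)-doubling along W, then (W,d_W,μ) is globally A-doubling: for every x∈W and every r>0, 0<μ(B_r(x))≤A(r)·μ(B_{r/2}(x))<∞, where balls are taken with respect to the induced length metric d_W. -/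
open Set Metric Filter MeasureTheory ENNReal NNReal

noncomputable section

theorem len_le_of_path {X : Type*} [PseudoEMetricSpace X] {S : Set X} {γ : ℝ → X} {a b : ℝ}
    (hab : a ≤ b) (hc : ContinuousOn γ (Icc a b)) (hm : MapsTo γ (Icc a b) S) :
    lengthEDistIn S (γ a) (γ b) ≤ eVariationOn γ (Icc a b) := by
  have hmaps : MapsTo (fun s : ℝ => a + s * (b - a)) (Icc 0 1) (Icc a b) := by
    intro s hs
    constructor
    · nlinarith [hs.1, hs.2, mul_nonneg hs.1 (sub_nonneg.2 hab)]
    · nlinarith [hs.1, hs.2, mul_nonneg (sub_nonneg.2 hs.2) (sub_nonneg.2 hab)]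
  have hmono : MonotoneOn (fun s : ℝ => a + s * (b - a)) (Icc 0 1) := by
    intro s _ t _ hst
    have := mul_le_mul_of_nonneg_right hst (sub_nonneg.2 hab)
    simp only
    linarith
  refine le_trans ?_ (eVariationOn.comp_le_of_monotoneOn γ (fun s : ℝ => a + s * (b - a)) hmono hmaps)
  unfold lengthEDistIn
  refine iInf_le_of_le (γ ∘ fun s : ℝ => a + s * (b - a)) ?_
  refine iInf_le_of_le (hc.comp (by fun_prop) hmaps) ?_
  refine iInf_le_of_le (by simp) ?_
  refine iInf_le_of_le (by simp) ?_
  exact iInf_le_of_le (hm.comp hmaps) le_rfl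

theorem exists_path_of_len_lt {X : Type*} [PseudoEMetricSpace X] {S : Set X} {x y : X} {c : ℝ≥0∞}
    (h : lengthEDistIn S x y < c) : ∃ γ : ℝ → X, ContinuousOn γ (Icc 0 1) ∧ γ 0 = x ∧ γ 1 = y ∧
      MapsTo γ (Icc 0 1) S ∧ eVariationOn γ (Icc 0 1) < c := by
  unfold lengthEDistIn at h
  simp only [iInf_lt_iff] at h
  obtain ⟨γ, h1, h2, h3, h4, h5⟩ := h
  exact ⟨γ, h1, h2, h3, h4, h5⟩

theorem len_symm_le {X : Type*} [PseudoEMetricSpace X] (S : Set X) (x y : X) :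
    lengthEDistIn S x y ≤ lengthEDistIn S y x := by
  refine le_of_forall_gt fun c hc => ?_
  obtain ⟨γ, h1, h2, h3, h4, h5⟩ := exists_path_of_len_lt hc
  have hmaps : MapsTo (fun s : ℝ => 1 - s) (Icc 0 1) (Icc 0 1) := by
    intro s hs
    exact ⟨by linarith [hs.2], by linarith [hs.1]⟩
  have hanti : AntitoneOn (fun s : ℝ => 1 - s) (Icc 0 1) := by
    intro s _ t _ hst
    simp only
    linarith
  refine lt_of_le_of_lt (le_trans ?_
    (eVariationOn.comp_le_of_antitoneOn γ (fun s : ℝ => 1 - s) hanti hmaps)) h5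
  have := len_le_of_path (S := S) (γ := γ ∘ fun s : ℝ => 1 - s) zero_le_one
    (h1.comp (by fun_prop) hmaps) (h4.comp hmaps)
  simpa [h2, h3] using this

theorem len_symm {X : Type*} [PseudoEMetricSpace X] (S : Set X) (x y : X) :
    lengthEDistIn S x y = lengthEDistIn S y x :=
  le_antisymm (len_symm_le S x y) (len_symm_le S y x)

theorem var_split {X : Type*} [PseudoEMetricSpace X] (γ : ℝ → X) {a b c : ℝ} (hab : a ≤ b)
    (hbc : b ≤ c) : eVariationOn γ (Icc a b) + eVariationOn γ (Icc b c)
      = eVariationOn γ (Icc a c) := by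
  simpa using eVariationOn.Icc_add_Icc γ (s := univ) hab hbc (mem_univ b)

theorem len_triangle_lt {X : Type*} [PseudoEMetricSpace X] {S : Set X} {x y z : X} {c d : ℝ≥0∞}
    (h : lengthEDistIn S x y < c) (h' : lengthEDistIn S y z < d) :
    lengthEDistIn S x z < c + d := by
  obtain ⟨γ, h1, h2, h3, h4, h5⟩ := exists_path_of_len_lt h
  obtain ⟨η, k1, k2, k3, k4, k5⟩ := exists_path_of_len_lt h'
  let ζ : ℝ → X := fun s => if s ≤ 1 then γ s else η (s - 1)
  have e1 : EqOn ζ γ (Icc 0 1) := fun s hs => by simp [ζ, hs.2]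
  have e2 : EqOn ζ (η ∘ fun s => s - 1) (Icc 1 2) := fun s hs => by
    by_cases hs1 : s ≤ 1
    · have : s = 1 := le_antisymm hs1 hs.1
      subst this
      simp [ζ, h3, k2]
    · simp [ζ, hs1]
  have hmaps : MapsTo (fun s : ℝ => s - 1) (Icc 1 2) (Icc 0 1) := by
    intro s hs
    exact ⟨by linarith [hs.1], by linarith [hs.2]⟩
  have hmono : MonotoneOn (fun s : ℝ => s - 1) (Icc 1 2) := by
    intro s _ t _ hst
    simp only
    linarith
  have hU : (Icc 0 1 ∪ Icc 1 2 : Set ℝ) = Icc 0 2 := Icc_union_Icc_eq_Icc (by norm_num) (by norm_num)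
  have c1 : ContinuousOn ζ (Icc 0 1) := h1.congr e1
  have c2 : ContinuousOn ζ (Icc 1 2) := (k1.comp (by fun_prop) hmaps).congr e2
  have cc : ContinuousOn ζ (Icc 0 2) := by
    rw [← hU]
    exact c1.union_of_isClosed c2 isClosed_Icc isClosed_Icc
  have mm : MapsTo ζ (Icc 0 2) S := by
    rw [← hU]
    exact (h4.congr e1.symm).union ((k4.comp hmaps).congr e2.symm)
  have key := len_le_of_path (by norm_num : (0:ℝ) ≤ 2) cc mm
  have z0 : ζ 0 = x := by simp [ζ, h2]
  have z2 : ζ 2 = z := by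
    have : (2:ℝ) - 1 = 1 := by norm_num
    simp [ζ, this, k3]
  rw [z0, z2, ← var_split ζ zero_le_one (by norm_num : (1:ℝ) ≤ 2), eVariationOn.congr e1,
    eVariationOn.congr e2] at key
  refine key.trans_lt (ENNReal.add_lt_add h5 (lt_of_le_of_lt ?_ k5))
  exact eVariationOn.comp_le_of_monotoneOn η _ hmono hmaps

theorem edist_le_len {X : Type*} [PseudoEMetricSpace X] (S : Set X) (x y : X) :
    edist x y ≤ lengthEDistIn S x y := by
  refine le_of_forall_gt fun c hc => ?_
  obtain ⟨γ, h1, h2, h3, h4, h5⟩ := exists_path_of_len_lt hc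
  rw [← h2, ← h3]
  exact (eVariationOn.edist_le γ (by simp) (by simp)).trans_lt h5

theorem len_self {X : Type*} [PseudoEMetricSpace X] {S : Set X} {x : X} (hx : x ∈ S) :
    lengthEDistIn S x x = 0 := by
  have := len_le_of_path (S := S) (γ := fun _ : ℝ => x) (zero_le_one) continuousOn_const
    (fun _ _ => hx)
  refine le_antisymm (this.trans ?_) zero_le
  exact (eVariationOn.constant_on (by simp [Set.subsingleton_singleton])).le

theorem dist_lt_of_len_lt {X : Type*} [MetricSpace X] {S : Set X} {x y : X} {c : ℝ}
    (h : lengthEDistIn S x y < ENNReal.ofReal c) : dist x y < c := by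
  have := (edist_le_len S x y).trans_lt h
  rw [edist_dist] at this
  exact (ENNReal.ofReal_lt_ofReal_iff_of_nonneg dist_nonneg).1 this

theorem eq_of_convergesIn {X : Type*} [MetricSpace X] {S : Set X} {u : ℕ → X} {w v : X}
    (h : ConvergesIn S u w) (hv : Tendsto u atTop (nhds v)) : v = w := by
  refine tendsto_nhds_unique hv ?_
  rw [tendsto_iff_edist_tendsto_0]
  exact tendsto_of_tendsto_of_tendsto_of_le_of_le tendsto_const_nhds h (fun _ => zero_le)
    (fun n => edist_le_len S _ _)

theorem cauchy_along {X : Type*} [MetricSpace X] {S : Set X} {γ : ℝ → X} {b : ℝ} 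
    (hv : eVariationOn γ (Icc 0 b) ≠ ⊤) (hc : ContinuousOn γ (Icc 0 b))
    (hm : MapsTo γ (Ico 0 b) S) {s : ℕ → ℝ} (hs : Monotone s) (hs0 : ∀ n, s n ∈ Ico 0 b) :
    IsCauchyIn S (fun n => γ (s n)) := by
  intro ε hε
  let v : ℕ → ℝ≥0∞ := fun n => eVariationOn γ (Icc 0 (s n))
  have hvm : Monotone v := fun m n hmn => eVariationOn.mono γ (Icc_subset_Icc_right (hs hmn))
  have hvL : Tendsto v atTop (nhds (⨆ n, v n)) := tendsto_atTop_iSup hvm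
  have hL : (⨆ n, v n) ≠ ⊤ := ne_top_of_le_ne_top hv
    (iSup_le fun n => eVariationOn.mono γ (Icc_subset_Icc_right (hs0 n).2.le))
  have h1 : Tendsto (fun n => v n + ε) atTop (nhds ((⨆ n, v n) + ε)) := hvL.add tendsto_const_nhds
  obtain ⟨N, hN⟩ := (h1.eventually (lt_mem_nhds (ENNReal.lt_add_right hL hε.ne'))).exists
  have main : ∀ m ≥ N, ∀ n ≥ m, lengthEDistIn S (γ (s m)) (γ (s n)) < ε := by
    intro m hm' n hn
    have hsub : Icc (s m) (s n) ⊆ Ico 0 b := fun y hy =>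
      ⟨(hs0 m).1.trans hy.1, hy.2.trans_lt (hs0 n).2⟩
    refine (len_le_of_path (hs hn) (hc.mono (hsub.trans Ico_subset_Icc_self))
      (hm.mono_left hsub)).trans_lt ?_
    have e := var_split γ (hs0 m).1 (hs hn)
    have h2 : v m + eVariationOn γ (Icc (s m) (s n)) < v m + ε := by
      calc v m + eVariationOn γ (Icc (s m) (s n)) = v n := e
        _ ≤ ⨆ n, v n := le_iSup v n
        _ < v N + ε := hN
        _ ≤ v m + ε := by gcongr; exact hvm hm'
    exact lt_of_add_lt_add_left h2
  refine ⟨N, fun m hm' n hn => ?_⟩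
  rcases le_total m n with h | h
  · exact main m hm' n h
  · rw [len_symm]
    exact main n hn m h

theorem ball_of_interior {X : Type*} [MetricSpace X] (hX : IsLengthSpace X) {W : Set X} {t : ℝ}
    {z w : X} (hz : z ∈ IntrinsicInterior W t) (hw : dist w z < t) :
    w ∈ W ∧ lengthEDistIn W z w < ENNReal.ofReal t := by
  obtain ⟨hzW, r, htr, hr⟩ := hz
  have ht : 0 < t := dist_nonneg.trans_lt hw
  have h0 : lengthEDistIn (univ : Set X) z w < ENNReal.ofReal t := by
    rw [← hX z w, edist_dist, dist_comm]
    exact (ENNReal.ofReal_lt_ofReal_iff ht).2 hw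
  obtain ⟨γ, h1, h2, h3, -, h5⟩ := exists_path_of_len_lt h0
  have hzi : z ∈ interior W := by
    obtain ⟨w', hw', hcv⟩ := hr (fun _ => z) (fun _ => hzW)
      (fun ε hε => ⟨0, fun _ _ _ _ => by simpa [len_self hzW] using hε⟩)
      ⟨t, htr, Eventually.of_forall fun _ => by simp [len_self hzW]⟩
    have := eq_of_convergesIn hcv tendsto_const_nhds
    rwa [this]
  have hmaps : MapsTo γ (Icc 0 1) (interior W) := by
    by_contra hcon
    let T : Set ℝ := Icc 0 1 ∩ γ ⁻¹' (interior W)ᶜ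
    have hTc : IsCompact T := by
      refine isCompact_Icc.of_isClosed_subset ?_ inter_subset_left
      exact h1.preimage_isClosed_of_isClosed isClosed_Icc isOpen_interior.isClosed_compl
    have hTn : T.Nonempty := by
      simp only [MapsTo, not_forall] at hcon
      obtain ⟨s, hs, hs'⟩ := hcon
      exact ⟨s, hs, hs'⟩
    obtain ⟨b, ⟨hb01, hbT⟩, hbl⟩ := hTc.exists_isLeast hTn
    have hlt : MapsTo γ (Ico 0 b) (interior W) := by
      intro s hs
      by_contra hcon
      exact absurd (hbl ⟨⟨hs.1, hs.2.le.trans hb01.2⟩, hcon⟩) (not_le.2 hs.2)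
    have hb0 : 0 < b := by
      rcases hb01.1.lt_or_eq with h | h
      · exact h
      · subst h
        exact absurd (by rw [h2]; exact hzi) hbT
    have hsub : Icc 0 b ⊆ Icc (0:ℝ) 1 := Icc_subset_Icc_right hb01.2
    let s : ℕ → ℝ := fun n => b - b / ((n:ℝ) + 1)
    have hsm : Monotone s := by
      intro m n hmn
      have : (m:ℝ) ≤ n := by exact_mod_cast hmn
      simp only [s]
      gcongr
    have hs0 : ∀ n, s n ∈ Ico 0 b := by
      intro n
      have hp : 0 < b / ((n:ℝ) + 1) := by positivity
      have hq : b / ((n:ℝ) + 1) ≤ b := div_le_self hb0.le (by linarith [n.cast_nonneg (α := ℝ)])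
      exact ⟨by simp only [s]; linarith, by simp only [s]; linarith⟩
    have hst : Tendsto s atTop (nhds b) := by
      have : Tendsto (fun n : ℕ => b - b * (1 / ((n:ℝ) + 1))) atTop (nhds (b - b * 0)) :=
        tendsto_const_nhds.sub (tendsto_const_nhds.mul tendsto_one_div_add_atTop_nhds_zero_nat)
      simpa [s, div_eq_mul_inv] using this
    have hcont : Tendsto (fun n => γ (s n)) atTop (nhds (γ b)) := by
      refine (h1 b hb01).tendsto.comp (tendsto_nhdsWithin_iff.2 ⟨hst, Eventually.of_forall ?_⟩)
      exact fun n => hsub (Ico_subset_Icc_self (hs0 n))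
    have hltW : MapsTo γ (Ico 0 b) W := fun s hs => interior_subset (hlt hs)
    obtain ⟨w', hw', hcv⟩ := hr (fun n => γ (s n)) (fun n => hltW (hs0 n))
      (cauchy_along (ne_top_of_le_ne_top h5.ne_top (eVariationOn.mono γ hsub)) (h1.mono hsub)
        hltW hsm hs0)
      ⟨t, htr, Eventually.of_forall fun n => by
        have hss : Icc 0 (s n) ⊆ Ico 0 b := Icc_subset_Ico_right (hs0 n).2
        have := len_le_of_path (hs0 n).1 (h1.mono ((hss.trans Ico_subset_Icc_self).trans hsub))
          (hltW.mono_left hss)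
        rw [h2] at this
        exact (this.trans (eVariationOn.mono γ ((hss.trans Ico_subset_Icc_self).trans hsub))).trans
          h5.le⟩
    have := eq_of_convergesIn hcv hcont
    exact hbT (by rw [mem_preimage] at *; rwa [this])
  have hmW : MapsTo γ (Icc 0 1) W := fun s hs => interior_subset (hmaps hs)
  constructor
  · rw [← h3]
    exact hmW (by simp)
  · have := len_le_of_path zero_le_one h1 hmW
    rw [h2, h3] at this
    exact this.trans_lt h5

theorem exists_step {X : Type*} [MetricSpace X] {W : Set X} {x y : X} (hx : x ∈ W) {L d : ℝ}
    (hL : 0 < L) (hd : 0 < d) (h : lengthEDistIn W x y < ENNReal.ofReal (L + d)) :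
    ∃ p ∈ W, lengthEDistIn W x p < ENNReal.ofReal L ∧ dist p y ≤ d := by
  by_cases hxy : dist x y ≤ d
  · exact ⟨x, hx, by simpa [len_self hx] using hL, hxy⟩
  push Not at hxy
  obtain ⟨γ, h1, h2, h3, h4, h5⟩ := exists_path_of_len_lt h
  have hc : ContinuousOn (fun s => dist (γ s) y) (Icc 0 1) := by fun_prop
  have hmem : d ∈ Icc ((fun s => dist (γ s) y) 1) ((fun s => dist (γ s) y) 0) := by
    simp [h2, h3, hxy.le, hd.le]
  obtain ⟨s, hs, hsd⟩ := intermediate_value_Icc' zero_le_one hc hmem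
  simp only at hsd
  refine ⟨γ s, h4 hs, ?_, hsd.le⟩
  have hsub : Icc 0 s ⊆ Icc (0:ℝ) 1 := Icc_subset_Icc_right hs.2
  have k := len_le_of_path hs.1 (h1.mono hsub) (h4.mono_left hsub)
  rw [h2] at k
  refine k.trans_lt ?_
  have e := var_split γ hs.1 hs.2
  have k2 : ENNReal.ofReal d ≤ eVariationOn γ (Icc s 1) := by
    rw [← hsd, ← edist_dist, ← h3]
    exact eVariationOn.edist_le γ ⟨le_rfl, hs.2⟩ ⟨hs.2, le_rfl⟩
  rw [ENNReal.ofReal_add hL.le hd.le] at h5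
  have : eVariationOn γ (Icc 0 s) + ENNReal.ofReal d < ENNReal.ofReal L + ENNReal.ofReal d :=
    lt_of_le_of_lt (by rw [← e]; gcongr) h5
  exact lt_of_add_lt_add_right this

section doubling

variable {X : Type*} [MetricSpace X] [MeasurableSpace X] [BorelSpace X] {μ : Measure X} {W : Set X}
  {r₀ : ℝ} {A₀ : ℝ≥0}

theorem iter_doubling (hD : DoublingAlong μ W r₀ A₀) (hr₀ : 0 < r₀) {p : X} (hp : p ∈ W) (k : ℕ)
    {s : ℝ} (hs : 0 < s) (hs' : s ≤ r₀) :
    μ (ball p s) ≤ (A₀ : ℝ≥0∞) ^ k * μ (ball p (s / 2 ^ k)) := by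
  induction k with
  | zero => simp
  | succ k ih =>
    have h2 : s / 2 ^ k ≤ s := div_le_self hs.le (one_le_pow₀ (by norm_num))
    have := (hD p ⟨p, hp, by simpa using hr₀⟩ (s / 2 ^ k) (by positivity) (h2.trans hs')).2.1
    calc μ (ball p s) ≤ (A₀ : ℝ≥0∞) ^ k * μ (ball p (s / 2 ^ k)) := ih
      _ ≤ (A₀ : ℝ≥0∞) ^ k * (A₀ * μ (ball p (s / 2 ^ k / 2))) := by gcongr
      _ = _ := by rw [pow_succ, mul_assoc, pow_succ, div_div]

theorem local_cover (hD : DoublingAlong μ W r₀ A₀) (hr₀ : 0 < r₀) {δ : ℝ} (hδ : 0 < δ)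
    (hδ' : 4 * δ ≤ r₀) {q : X} (hq : q ∈ W) :
    ∃ G ⊆ W, W ∩ ball q (2 * δ) ⊆ ⋃ g ∈ G, ball g δ ∧
      ∑' g : G, μ (ball (g : X) δ) ≤ (A₀ : ℝ≥0∞) ^ 3 * μ (ball q δ) := by
  obtain ⟨G, hG, hdis, hcov⟩ := Vitali.exists_disjoint_subfamily_covering_enlargement
    (fun a : X => ball a (δ / 2)) (W ∩ ball q (2 * δ)) (fun _ => 1) 2 (by norm_num)
    (fun _ _ => zero_le_one) 1 (fun _ _ => le_rfl) (fun a _ => ⟨a, by simpa using hδ⟩)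
  refine ⟨G, fun g hg => (hG hg).1, ?_, ?_⟩
  · intro a ha
    obtain ⟨b, hb, ⟨c, hc1, hc2⟩, -⟩ := hcov a ha
    rw [mem_ball] at hc1 hc2
    refine mem_iUnion₂.2 ⟨b, hb, ?_⟩
    rw [mem_ball]
    have := dist_triangle_left a b c
    linarith
  · have hU : (⋃ g : G, ball (g : X) (δ / 2)) ⊆ ball q (4 * δ) := by
      refine iUnion_subset fun g => ball_subset_ball' ?_
      have := mem_ball.1 (hG g.2).2
      linarith
    have hq4 := iter_doubling hD hr₀ hq 2 (s := 4 * δ) (by positivity) hδ'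
    have e4 : 4 * δ / 2 ^ 2 = δ := by ring
    rw [e4] at hq4
    calc ∑' g : G, μ (ball (g : X) δ) ≤ ∑' g : G, A₀ * μ (ball (g : X) (δ / 2)) := by
          refine ENNReal.tsum_le_tsum fun g => ?_
          have hg := (hG g.2).1
          exact (hD g ⟨g, hg, by simpa using hr₀⟩ δ hδ (by linarith)).2.1
      _ = A₀ * ∑' g : G, μ (ball (g : X) (δ / 2)) := ENNReal.tsum_mul_left
      _ ≤ A₀ * μ (⋃ g : G, ball (g : X) (δ / 2)) := by
          gcongr
          refine tsum_meas_le_meas_iUnion_of_disjoint μ (fun g => measurableSet_ball) ?_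
          intro a b hab
          exact hdis a.2 b.2 (fun h => hab (Subtype.ext h))
      _ ≤ A₀ * ((A₀ : ℝ≥0∞) ^ 2 * μ (ball q δ)) := by
          gcongr
          exact (measure_mono hU).trans hq4
      _ = _ := by ring

theorem chain_cover (hD : DoublingAlong μ W r₀ A₀) (hr₀ : 0 < r₀) {δ : ℝ} (hδ : 0 < δ)
    (hδ' : 4 * δ ≤ r₀) {x : X} (hx : x ∈ W) (m : ℕ) :
    ∃ F ⊆ W, {y ∈ W | lengthEDistIn W x y < ENNReal.ofReal ((m + 1) * (δ / 2))} ⊆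
        ⋃ g ∈ F, ball g δ ∧
      ∑' g : F, μ (ball (g : X) δ) ≤ ((A₀ : ℝ≥0∞) ^ 3) ^ m * μ (ball x δ) := by
  induction m with
  | zero =>
    refine ⟨{x}, by simpa using hx, ?_, by simp⟩
    rintro y ⟨-, hy⟩
    have := dist_lt_of_len_lt hy
    rw [dist_comm] at this
    simp at this ⊢
    linarith
  | succ m ih =>
    obtain ⟨F, hF, hcov, hsum⟩ := ih
    choose! G hG hGc hGs using fun q (hq : q ∈ W) => local_cover hD hr₀ hδ hδ' hq
    refine ⟨⋃ q ∈ F, G q, iUnion₂_subset fun q hq => hG q (hF hq), ?_, ?_⟩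
    · rintro y ⟨hyW, hy⟩
      have e : ((m + 1 : ℕ) + 1 : ℝ) * (δ / 2) = (m + 1) * (δ / 2) + δ / 2 := by push_cast; ring
      rw [e] at hy
      obtain ⟨p, hp, hp1, hp2⟩ := exists_step hx (by positivity) (by positivity) hy
      obtain ⟨q, hq, hpq⟩ := mem_iUnion₂.1 (hcov ⟨hp, hp1⟩)
      have hyq : y ∈ W ∩ ball q (2 * δ) := by
        refine ⟨hyW, ?_⟩
        rw [mem_ball] at hpq ⊢
        have := dist_triangle_left y q p
        linarith
      obtain ⟨g, hg, hyg⟩ := mem_iUnion₂.1 (hGc q (hF hq) hyq)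
      exact mem_iUnion₂.2 ⟨g, mem_iUnion₂.2 ⟨q, hq, hg⟩, hyg⟩
    · calc ∑' g : ⋃ q ∈ F, G q, μ (ball (g : X) δ)
          ≤ ∑' q : F, ∑' g : G q, μ (ball (g : X) δ) :=
            ENNReal.tsum_biUnion_le_tsum (fun g => μ (ball g δ)) F G
        _ ≤ ∑' q : F, (A₀ : ℝ≥0∞) ^ 3 * μ (ball (q : X) δ) :=
            ENNReal.tsum_le_tsum fun q => hGs q (hF q.2)
        _ = (A₀ : ℝ≥0∞) ^ 3 * ∑' q : F, μ (ball (q : X) δ) := ENNReal.tsum_mul_left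
        _ ≤ (A₀ : ℝ≥0∞) ^ 3 * (((A₀ : ℝ≥0∞) ^ 3) ^ m * μ (ball x δ)) := by gcongr
        _ = _ := by ring

theorem ball_finite (hD : DoublingAlong μ W r₀ A₀) (hr₀ : 0 < r₀) {δ : ℝ} (hδ : 0 < δ)
    (hδ' : 4 * δ ≤ r₀) {x : X} (hx : x ∈ W) : μ (ball x δ) < ⊤ :=
  have h := hD x ⟨x, hx, by simpa using hr₀⟩ δ hδ (by linarith)
  h.2.1.trans_lt h.2.2

theorem measure_chain (hD : DoublingAlong μ W r₀ A₀) (hr₀ : 0 < r₀) {δ : ℝ} (hδ : 0 < δ)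
    (hδ' : 4 * δ ≤ r₀) {x : X} (hx : x ∈ W) (m : ℕ) :
    μ {y ∈ W | lengthEDistIn W x y < ENNReal.ofReal ((m + 1) * (δ / 2))} ≤
      ((A₀ : ℝ≥0∞) ^ 3) ^ m * μ (ball x δ) := by
  obtain ⟨F, hF, hcov, hsum⟩ := chain_cover hD hr₀ hδ hδ' hx m
  have hfin : ((A₀ : ℝ≥0∞) ^ 3) ^ m * μ (ball x δ) < ⊤ :=
    ENNReal.mul_lt_top (by finiteness) (ball_finite hD hr₀ hδ hδ' hx)
  have hcount : F.Countable := by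
    have h := Summable.countable_support_ennreal (hsum.trans_lt hfin).ne
    have hs : Function.support (fun g : F => μ (ball (g : X) δ)) = univ := by
      refine eq_univ_of_forall fun g => ?_
      have hg := hF g.2
      exact (hD g ⟨g, hg, by simpa using hr₀⟩ δ hδ (by linarith)).1.ne'
    rw [hs] at h
    exact countable_univ_iff.1 h
  exact (measure_mono hcov).trans ((measure_biUnion_le μ hcount _).trans hsum)

end doubling

/-- **Theorem 2** of the paper (metric-measure form): an undistorted domain of
`τ`-Lipschitz type with width `≥ t₀`, in a length space whose `r₀`-neighborhood of `W`
has complete closure and which carries a measure `(r₀, A₀)`-doubling along `W`, is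
globally `A`-doubling in its induced length metric `d_W`, where the nondecreasing
function `A` depends only on `τ, r₀, t₀, A₀`. -/
theorem lipschitz_type_globally_doubling
    (τ r₀ t₀ : ℝ) (hτ : 1 ≤ τ) (hr₀ : 0 < r₀) (ht₀ : 0 < t₀)
    (A₀ : ℝ≥0) (hA₀ : 1 ≤ A₀) :
    ∃ A : ℝ → ℝ≥0,
      (∀ r₁ r₂ : ℝ, 0 < r₁ → r₁ ≤ r₂ → A r₁ ≤ A r₂) ∧
      (∀ r : ℝ, 0 < r → 1 ≤ A r) ∧
      ∀ (X : Type) [MetricSpace X] [MeasurableSpace X] [BorelSpace X]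
        (μ : Measure X) (W : Set X),
        IsLengthSpace X → IsDomainIn W →
        UndistortedDomain W (fun t => τ * t) t₀ →
        IsComplete (closure {z : X | ∃ w ∈ W, dist z w < r₀}) →
        DoublingAlong μ W r₀ A₀ →
        ∀ x ∈ W, ∀ r : ℝ, 0 < r →
          0 < μ {y ∈ W | lengthEDistIn W x y < ENNReal.ofReal r} ∧
          μ {y ∈ W | lengthEDistIn W x y < ENNReal.ofReal r} ≤
            (A r : ℝ≥0∞) * μ {y ∈ W | lengthEDistIn W x y < ENNReal.ofReal (r / 2)} ∧
          (A r : ℝ≥0∞) * μ {y ∈ W | lengthEDistIn W x y < ENNReal.ofReal (r / 2)} < ⊤ := by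
  obtain ⟨k, hk⟩ := pow_unbounded_of_one_lt (8 * τ) (by norm_num : (1:ℝ) < 2)
  set r₁ := min t₀ (r₀ / 4) with hr₁
  have hr₁0 : 0 < r₁ := by positivity
  refine ⟨fun r => (A₀ ^ 3) ^ (⌈2 * r / r₁⌉₊ + 2) * A₀ ^ (k + 1), ?_, ?_, ?_⟩
  · intro a b ha hab
    have h3 : 1 ≤ A₀ ^ 3 := one_le_pow₀ hA₀
    simp only
    gcongr
  · intro r hr
    exact one_le_mul (one_le_pow₀ (one_le_pow₀ hA₀)) (one_le_pow₀ hA₀)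
  intro X _ _ _ μ W hX _ hU _ hD x hx r hr
  set m := ⌈2 * r / r₁⌉₊ + 2 with hm
  set δ := min r r₁ with hδdef
  have hδ : 0 < δ := lt_min hr hr₁0
  have hδ1 : δ ≤ r₁ := min_le_right _ _
  have hδr : δ ≤ r := min_le_left _ _
  have hδ4 : 4 * δ ≤ r₀ := by
    have : r₁ ≤ r₀ / 4 := min_le_right _ _
    linarith
  have hτ0 : 0 < τ := by linarith
  have hmr : r ≤ (m + 1) * (δ / 2) := by
    have hc := Nat.le_ceil (2 * r / r₁)
    have hm' : (m : ℝ) = ⌈2 * r / r₁⌉₊ + 2 := by rw [hm]; push_cast; ring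
    rcases min_choice r r₁ with h | h
    · rw [hδdef, h, hm']
      nlinarith [Nat.cast_nonneg (α := ℝ) ⌈2 * r / r₁⌉₊, mul_nonneg (Nat.cast_nonneg (α := ℝ) ⌈2 * r / r₁⌉₊) hr.le]
    · rw [hδdef, h, hm']
      rw [div_le_iff₀ hr₁0] at hc
      nlinarith
  have hup : μ {y ∈ W | lengthEDistIn W x y < ENNReal.ofReal r} ≤
      ((A₀ : ℝ≥0∞) ^ 3) ^ m * μ (ball x δ) := by
    refine (measure_mono ?_).trans (measure_chain hD hr₀ hδ hδ4 hx m)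
    rintro y ⟨hy, hy'⟩
    exact ⟨hy, hy'.trans_le (ENNReal.ofReal_le_ofReal hmr)⟩
  set t := δ / (8 * τ) with ht
  have ht0 : 0 < t := by positivity
  have htδ : t ≤ δ / 8 := by
    rw [ht]
    gcongr
    linarith
  have htt₀ : t ≤ t₀ := by
    have : r₁ ≤ t₀ := min_le_left _ _
    linarith
  have hτt : τ * t = δ / 8 := by rw [ht]; field_simp
  obtain ⟨y, hyW, hxy, z, hz, hyz⟩ := hU t ht0 htt₀ x hx (δ / 8) (by positivity)
  simp only [hτt] at hyz
  have hxz := len_triangle_lt hxy hyz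
  rw [← ENNReal.ofReal_add (by positivity) (by positivity)] at hxz
  have hzW : z ∈ W := hz.1
  have hsub : ball z t ⊆ {y ∈ W | lengthEDistIn W x y < ENNReal.ofReal (r / 2)} := by
    intro w hw
    obtain ⟨hwW, hzw⟩ := ball_of_interior hX hz (mem_ball.1 hw)
    refine ⟨hwW, ?_⟩
    have := len_triangle_lt hxz hzw
    rw [← ENNReal.ofReal_add (by positivity) (by positivity)] at this
    exact this.trans_le (ENNReal.ofReal_le_ofReal (by linarith))
  have hmono : {y ∈ W | lengthEDistIn W x y < ENNReal.ofReal (r / 2)} ⊆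
      {y ∈ W | lengthEDistIn W x y < ENNReal.ofReal r} := by
    rintro w ⟨hw, hw'⟩
    exact ⟨hw, hw'.trans_le (ENNReal.ofReal_le_ofReal (by linarith))⟩
  have hlow : μ (ball x δ) ≤ (A₀ : ℝ≥0∞) ^ (k + 1) *
      μ {y ∈ W | lengthEDistIn W x y < ENNReal.ofReal (r / 2)} := by
    have hd := dist_lt_of_len_lt hxz
    calc μ (ball x δ) ≤ μ (ball z (2 * δ)) := measure_mono (ball_subset_ball' (by linarith))
      _ ≤ (A₀ : ℝ≥0∞) ^ (k + 1) * μ (ball z (2 * δ / 2 ^ (k + 1))) :=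
        iter_doubling hD hr₀ hzW (k + 1) (by positivity) (by linarith)
      _ ≤ _ := by
        gcongr
        refine (ball_subset_ball ?_).trans hsub
        have : 2 * δ / 2 ^ (k + 1) = δ / 2 ^ k := by rw [pow_succ]; field_simp
        rw [this, ht]
        gcongr
  have hpos : 0 < μ (ball z t) :=
    (hD z ⟨z, hzW, by simpa using hr₀⟩ t ht0 (by linarith)).1
  refine ⟨hpos.trans_le (measure_mono (hsub.trans hmono)), ?_, ?_⟩
  · refine hup.trans ?_
    push_cast
    rw [mul_assoc]
    gcongr
  · refine ENNReal.mul_lt_top ENNReal.coe_lt_top ?_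
    refine (measure_mono hmono).trans_lt (hup.trans_lt ?_)
    exact ENNReal.mul_lt_top (by finiteness) (ball_finite hD hr₀ hδ hδ4 hx)
end
end

section
/- Fix r>0 and a nondecreasing function A:(0,∞)→[1,∞). (a) For every R>0, the family of all pointed metric spaces (B_R(p,X_r°), d|, p) — where (X,d) is a length space carrying an A-interior-doubling Borel measure, p∈X_r° is a point of the r-interior, B_R(p,X_r°) denotes the open R-ball around p in (X_r°, d_{X_r°}), and d| is the metric restricted from (X,d) — is uniformly totally bounded, hence precompact in the pointed Gromov–Hausdorff topology. (b) Consequently, for every D>0, the family of all spaces (X_r°, d|_{X_r°}) over such X with intrinsic diameter diam(X_r°, d_{X_r°}) ≤ D is precompact in the Gromov–Hausdorff topology. -/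
open Set Metric Filter MeasureTheory ENNReal NNReal

noncomputable section

/-- The boundary `∂X = X̄ ∖ X` of a (possibly incomplete) metric space inside its
metric completion. -/
def completionBoundary (X : Type*) [MetricSpace X] : Set (UniformSpace.Completion X) :=
  {q | q ∉ Set.range ((↑) : X → UniformSpace.Completion X)}

/-- The `r`-interior `X_r° = {x ∈ X : d̄(x, ∂X) > r}` of a (possibly incomplete)
metric space, where distances to the boundary are measured in the completion. -/
def rInterior (X : Type*) [MetricSpace X] (r : ℝ) : Set X :=
  {x : X | ENNReal.ofReal r <
    EMetric.infEdist ((x : X) : UniformSpace.Completion X) (completionBoundary X)}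

/-- A Borel measure `μ` on `X` is `A`-interior-doubling: the `A(s)`-doubling condition
holds at every `x` and scale `s` such that the closed `s`-ball around `x` in the
completion of `X` is contained in `X`. -/
def InteriorDoubling {X : Type*} [MetricSpace X] [MeasurableSpace X]
    (μ : Measure X) (A : ℝ → ℝ≥0) : Prop :=
  ∀ (x : X) (s : ℝ), 0 < s →
    Metric.closedBall ((x : X) : UniformSpace.Completion X) s ⊆
      Set.range ((↑) : X → UniformSpace.Completion X) →
    0 < μ (Metric.ball x s) ∧
    μ (Metric.ball x s) ≤ (A s : ℝ≥0∞) * μ (Metric.ball x (s / 2)) ∧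
    (A s : ℝ≥0∞) * μ (Metric.ball x (s / 2)) < ⊤


theorem aux_exists_net {X : Type} [MetricSpace X] (T : Set X) (d : ℝ) (hd : 0 < d) (n : ℕ)
    (h : ∀ F : Finset X, ↑F ⊆ T → (∀ a ∈ F, ∀ b ∈ F, a ≠ b → d ≤ dist a b) → F.card ≤ n) :
    ∃ F : Finset X, ↑F ⊆ T ∧ F.card ≤ n ∧ ∀ x ∈ T, ∃ y ∈ F, dist x y < d := by
  classical
  by_contra hcon
  push Not at hcon
  have key : ∀ k : ℕ, ∃ F : Finset X, ↑F ⊆ T ∧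
      (∀ a ∈ F, ∀ b ∈ F, a ≠ b → d ≤ dist a b) ∧ F.card = k := by
    intro k
    induction k with
    | zero => exact ⟨∅, by simp, by simp, rfl⟩
    | succ k ih =>
      obtain ⟨F, hF, hs, hc⟩ := ih
      obtain ⟨x, hx, hxy⟩ := hcon F hF (h F hF hs)
      have hxF : x ∉ F := fun hm => by
        have := hxy x hm
        rw [dist_self] at this
        linarith
      refine ⟨insert x F, ?_, ?_, ?_⟩
      · intro z hz
        rcases Finset.mem_insert.1 (Finset.mem_coe.1 hz) with rfl | hz
        · exact hx
        · exact hF hz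
      · intro a ha b hb hab
        rcases Finset.mem_insert.1 ha with ha1 | ha <;> rcases Finset.mem_insert.1 hb with hb1 | hb
        · exact absurd (ha1.trans hb1.symm) hab
        · rw [ha1]; exact hxy b hb
        · rw [hb1, dist_comm]; exact hxy a ha
        · exact hs a ha b hb hab
      · rw [Finset.card_insert_of_notMem hxF, hc]
  obtain ⟨F, hF, hs, hc⟩ := key (n + 1)
  have := h F hF hs
  omega

theorem aux_closedBall {X : Type} [MetricSpace X] {r : ℝ} {x : X} (hx : x ∈ rInterior X r)
    {s : ℝ} (hs : s ≤ r) :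
    Metric.closedBall ((x : X) : UniformSpace.Completion X) s ⊆
      Set.range ((↑) : X → UniformSpace.Completion X) := by
  intro q hq
  by_contra hn
  have h1 : q ∈ completionBoundary X := hn
  have hx' : ENNReal.ofReal r <
    Metric.infEDist ((x : X) : UniformSpace.Completion X) (completionBoundary X) := hx
  have h2 := Metric.infEDist_le_edist_of_mem (x := (x : UniformSpace.Completion X)) h1
  have h3 : edist (x : UniformSpace.Completion X) q ≤ ENNReal.ofReal r := by
    rw [edist_dist, dist_comm]
    exact ENNReal.ofReal_le_ofReal (le_trans hq hs)
  exact absurd (hx'.trans_le (h2.trans h3)) (lt_irrefl _)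

theorem aux_doubling {X : Type} [MetricSpace X] [MeasurableSpace X] {μ : Measure X}
    {r : ℝ} (hr : 0 < r) {A : ℝ → ℝ≥0}
    (hA_mono : ∀ a b : ℝ, 0 < a → a ≤ b → A a ≤ A b)
    (hμ : InteriorDoubling μ A) {x : X} (hx : x ∈ rInterior X r) (m : ℕ) :
    μ (Metric.ball x r) ≤ ((A r : ℝ≥0∞)) ^ m * μ (Metric.ball x (r / 2 ^ m)) := by
  induction m with
  | zero => simp
  | succ m ih =>
    have hp : 0 < r / 2 ^ m := by positivity
    have hle : r / 2 ^ m ≤ r := div_le_self hr.le (one_le_pow₀ (by norm_num))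
    have h := (hμ x (r / 2 ^ m) hp (aux_closedBall hx hle)).2.1
    have h2 : r / 2 ^ m / 2 = r / 2 ^ (m + 1) := by rw [pow_succ]; field_simp
    rw [h2] at h
    calc _ ≤ _ := ih
      _ ≤ (A r : ℝ≥0∞) ^ m * ((A r : ℝ≥0∞) * μ (Metric.ball x (r / 2 ^ (m + 1)))) := by
        gcongr
        refine h.trans ?_
        gcongr
        exact hA_mono _ _ hp hle
      _ = _ := by rw [← mul_assoc, ← pow_succ]

theorem aux_local {X : Type} [MetricSpace X] [MeasurableSpace X] [BorelSpace X] {μ : Measure X}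
    {r : ℝ} (hr : 0 < r) {A : ℝ → ℝ≥0}
    (hA_mono : ∀ a b : ℝ, 0 < a → a ≤ b → A a ≤ A b)
    (hμ : InteriorDoubling μ A) {x : X} (hx : x ∈ rInterior X r) (m : ℕ) (hm : 1 ≤ m) :
    ∃ F : Finset X, ↑F ⊆ rInterior X r ∧ F.card ≤ ⌊(A r) ^ m⌋₊ ∧
      ∀ z ∈ rInterior X r, dist z x ≤ r / 4 → ∃ y ∈ F, dist z y < 2 * (r / 2 ^ m) := by
  have hs : 0 < r / 2 ^ m := by positivity
  have hs2 : r / 2 ^ m ≤ r / 2 := by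
    gcongr
    calc (2 : ℝ) = 2 ^ 1 := by norm_num
      _ ≤ 2 ^ m := pow_le_pow_right₀ (by norm_num) hm
  obtain ⟨F, hF, hc, hcov⟩ := aux_exists_net {z | z ∈ rInterior X r ∧ dist z x ≤ r / 4}
    (2 * (r / 2 ^ m)) (by positivity) ⌊(A r) ^ m⌋₊ (by
      intro F hF hsep
      set s := r / 2 ^ m with hsdef
      have hD := hμ x r hr (aux_closedBall hx le_rfl)
      have hD2 := hμ x (r / 2) (by positivity) (aux_closedBall hx (by linarith))
      set V := μ (Metric.ball x (3 * r / 4)) with hV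
      have hV0 : V ≠ 0 := by
        refine (hD2.1.trans_le (measure_mono (Metric.ball_subset_ball (by linarith)))).ne'
      have hVt : V ≠ ⊤ := by
        refine ((measure_mono (Metric.ball_subset_ball (by linarith))).trans_lt
          (hD.2.1.trans_lt hD.2.2)).ne
      have h1 : ∑ y ∈ F, μ (Metric.ball y s) ≤ V := by
        rw [← measure_biUnion_finset]
        · refine measure_mono ?_
          refine Set.iUnion₂_subset fun y hy => Metric.ball_subset_ball' ?_
          have := (hF hy).2
          linarith
        · intro a ha b hb hab
          refine Metric.ball_disjoint_ball ?_
          have := hsep a ha b hb hab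
          linarith
        · intro y _
          exact Metric.isOpen_ball.measurableSet
      have h2 : ∀ y ∈ F, V ≤ (A r : ℝ≥0∞) ^ m * μ (Metric.ball y s) := by
        intro y hy
        refine le_trans (measure_mono (Metric.ball_subset_ball' ?_))
          (aux_doubling hr hA_mono hμ (hF hy).1 m)
        have := (hF hy).2
        rw [dist_comm] at this
        linarith
      have h3 : (F.card : ℝ≥0∞) * V ≤ (A r : ℝ≥0∞) ^ m * V := by
        calc (F.card : ℝ≥0∞) * V = ∑ y ∈ F, V := by simp
          _ ≤ ∑ y ∈ F, (A r : ℝ≥0∞) ^ m * μ (Metric.ball y s) := Finset.sum_le_sum h2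
          _ = (A r : ℝ≥0∞) ^ m * ∑ y ∈ F, μ (Metric.ball y s) := by rw [Finset.mul_sum]
          _ ≤ _ := by gcongr
      have h4 : (F.card : ℝ≥0∞) ≤ (A r : ℝ≥0∞) ^ m := (ENNReal.mul_le_mul_iff_left hV0 hVt).1 h3
      exact Nat.le_floor (by exact_mod_cast h4))
  exact ⟨F, fun y hy => (hF hy).1, hc, fun z hz hzx => hcov z ⟨hz, hzx⟩⟩

theorem aux_global {X : Type} [MetricSpace X] [MeasurableSpace X] [BorelSpace X] {μ : Measure X}
    {r : ℝ} (hr : 0 < r) {A : ℝ → ℝ≥0}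
    (hA_mono : ∀ a b : ℝ, 0 < a → a ≤ b → A a ≤ A b)
    (hμ : InteriorDoubling μ A) (m : ℕ) (hm : 1 ≤ m) (T : Set X) (G : Finset X)
    (hG : ↑G ⊆ rInterior X r)
    (hT : ∀ z ∈ T, z ∈ rInterior X r ∧ ∃ x ∈ G, dist z x ≤ r / 4) :
    ∃ F : Finset X, ↑F ⊆ rInterior X r ∧ F.card ≤ G.card * ⌊(A r) ^ m⌋₊ ∧
      ∀ z ∈ T, ∃ y ∈ F, dist z y < 2 * (r / 2 ^ m) := by
  classical
  have hl : ∀ x : X, ∃ F : Finset X, x ∈ G → ↑F ⊆ rInterior X r ∧ F.card ≤ ⌊(A r) ^ m⌋₊ ∧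
      ∀ z ∈ rInterior X r, dist z x ≤ r / 4 → ∃ y ∈ F, dist z y < 2 * (r / 2 ^ m) := by
    intro x
    by_cases hx : x ∈ G
    · obtain ⟨F, hF⟩ := aux_local hr hA_mono hμ (hG hx) m hm
      exact ⟨F, fun _ => hF⟩
    · exact ⟨∅, fun h => absurd h hx⟩
  choose f hf using hl
  refine ⟨G.biUnion f, ?_, ?_, ?_⟩
  · intro y hy
    obtain ⟨x, hx, hy⟩ := Finset.mem_biUnion.1 (Finset.mem_coe.1 hy)
    exact (hf x hx).1 hy
  · exact Finset.card_biUnion_le_card_mul _ _ _ fun x hx => (hf x hx).2.1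
  · intro z hz
    obtain ⟨hzi, x, hx, hzx⟩ := hT z hz
    obtain ⟨y, hy, hzy⟩ := (hf x hx).2.2 z hzi hzx
    exact ⟨y, Finset.mem_biUnion.2 ⟨x, hx, hy⟩, hzy⟩

/-- points reachable from `p` by chains of `k` steps of size at most `δ` inside `S` -/
def auxChain {X : Type} [MetricSpace X] (S : Set X) (δ : ℝ) (p : X) : ℕ → Set X
  | 0 => {p}
  | k + 1 => {z | z ∈ S ∧ ∃ w ∈ auxChain S δ p k, dist z w ≤ δ}

theorem aux_chain_mono {X : Type} [MetricSpace X] (S : Set X) (δ : ℝ) (hδ : 0 < δ) (p : X)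
    (hp : p ∈ S) (k : ℕ) : auxChain S δ p k ⊆ auxChain S δ p (k + 1) := by
  intro z hz
  refine ⟨?_, z, hz, by simpa using hδ.le⟩
  cases k with
  | zero => rw [auxChain, Set.mem_singleton_iff] at hz; exact hz ▸ hp
  | succ k => exact hz.1

theorem aux_path_s9 {X : Type} [MetricSpace X] (S : Set X) (δ : ℝ) (hδ : 0 < δ) (p : X) (hp : p ∈ S)
    (γ : ℝ → X) (hγ : ContinuousOn γ (Set.Icc 0 1)) (hS : Set.MapsTo γ (Set.Icc 0 1) S)
    (k : ℕ) : ∀ (j : ℕ) (a : ℝ), a ∈ Set.Icc (0 : ℝ) 1 → γ a ∈ auxChain S δ p j →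
      eVariationOn γ (Set.Icc a 1) < ENNReal.ofReal (k * δ) → γ 1 ∈ auxChain S δ p (j + k) := by
  induction k with
  | zero => intro j a _ _ h; simp at h
  | succ k ih =>
    intro j a ha hj h
    have h1 : (1 : ℝ) ∈ Set.Icc (0 : ℝ) 1 := by simp
    by_cases hd : dist (γ 1) (γ a) ≤ δ
    · have : γ 1 ∈ auxChain S δ p (j + 1) := ⟨hS h1, γ a, hj, hd⟩
      have hmono : Monotone (auxChain S δ p) :=
        monotone_nat_of_le_succ (aux_chain_mono S δ hδ p hp)
      exact hmono (by omega) this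
    · push Not at hd
      have hsub : Set.Icc a 1 ⊆ Set.Icc (0 : ℝ) 1 := Set.Icc_subset_Icc_left ha.1
      have hc : ContinuousOn (fun t => dist (γ t) (γ a)) (Set.Icc a 1) :=
        fun t ht => Filter.Tendsto.dist (hγ.mono hsub t ht) tendsto_const_nhds
      obtain ⟨t, ht, hte⟩ := intermediate_value_Icc ha.2 hc
        (show δ ∈ Set.Icc (dist (γ a) (γ a)) (dist (γ 1) (γ a)) from
          ⟨by simpa using hδ.le, hd.le⟩)
      have hte : dist (γ t) (γ a) = δ := hte
      have hadd := eVariationOn.Icc_add_Icc γ (s := Set.univ) ht.1 ht.2 (Set.mem_univ t)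
      simp only [Set.univ_inter] at hadd
      have hed : ENNReal.ofReal δ ≤ eVariationOn γ (Set.Icc a t) := by
        rw [← hte, ← edist_dist]
        exact eVariationOn.edist_le _ ⟨ht.1, le_rfl⟩ ⟨le_rfl, ht.1⟩
      have hlt : eVariationOn γ (Set.Icc t 1) < ENNReal.ofReal (k * δ) := by
        by_contra hn
        push Not at hn
        have : ENNReal.ofReal ((k + 1 : ℕ) * δ) ≤ eVariationOn γ (Set.Icc a 1) := by
          rw [← hadd]
          refine le_trans (le_of_eq ?_) (add_le_add hed hn)
          rw [← ENNReal.ofReal_add hδ.le (by positivity)]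
          push_cast
          ring_nf
        exact absurd h (not_lt.2 this)
      have := ih (j + 1) t (hsub ht) ⟨hS (hsub ht), γ a, hj, hte.le⟩ hlt
      rwa [show j + 1 + k = j + (k + 1) by omega] at this

theorem aux_ball_chain {X : Type} [MetricSpace X] (S : Set X) (δ : ℝ) (hδ : 0 < δ) (p : X)
    (hp : p ∈ S) (R : ℝ) (x : X) (h : lengthEDistIn S p x < ENNReal.ofReal R) :
    x ∈ auxChain S δ p ⌈R / δ⌉₊ := by
  unfold lengthEDistIn at h
  simp only [iInf_lt_iff] at h
  obtain ⟨γ, hγ, h0, h1, hS, hv⟩ := h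
  have := aux_path_s9 S δ hδ p hp γ hγ hS ⌈R / δ⌉₊ 0 0 (by simp)
    (by rw [h0]; exact Set.mem_singleton p) (hv.trans_le (ENNReal.ofReal_le_ofReal (by
      have := Nat.le_ceil (R / δ)
      rwa [div_le_iff₀ hδ] at this)))
  rwa [h1, zero_add] at this

theorem aux_chain_cover {X : Type} [MetricSpace X] [MeasurableSpace X] [BorelSpace X]
    {μ : Measure X} {r : ℝ} (hr : 0 < r) {A : ℝ → ℝ≥0}
    (hA_mono : ∀ a b : ℝ, 0 < a → a ≤ b → A a ≤ A b)
    (hμ : InteriorDoubling μ A) (p : X) (hp : p ∈ rInterior X r) (k : ℕ) :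
    ∃ F : Finset X, ↑F ⊆ rInterior X r ∧ F.card ≤ ⌊(A r) ^ 4⌋₊ ^ k ∧
      ∀ z ∈ auxChain (rInterior X r) (r / 8) p k, ∃ y ∈ F, dist z y ≤ r / 8 := by
  induction k with
  | zero =>
    refine ⟨{p}, by simpa using hp, by simp, ?_⟩
    intro z hz
    rw [auxChain, Set.mem_singleton_iff] at hz
    exact ⟨p, by simp, by rw [hz, dist_self]; positivity⟩
  | succ k ih =>
    obtain ⟨G, hG, hGc, hcov⟩ := ih
    obtain ⟨F, hF, hFc, hFcov⟩ := aux_global hr hA_mono hμ 4 (by norm_num)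
      (auxChain (rInterior X r) (r / 8) p (k + 1)) G hG (by
        rintro z ⟨hz, w, hw, hzw⟩
        obtain ⟨x, hx, hwx⟩ := hcov w hw
        exact ⟨hz, x, hx, by linarith [dist_triangle z w x]⟩)
    refine ⟨F, hF, ?_, ?_⟩
    · rw [pow_succ]
      exact hFc.trans (Nat.mul_le_mul_right _ hGc)
    · intro z hz
      obtain ⟨y, hy, hzy⟩ := hFcov z hz
      exact ⟨y, hy, by linarith⟩

theorem aux_main (r : ℝ) (hr : 0 < r) (A : ℝ → ℝ≥0)
    (hA_mono : ∀ a b : ℝ, 0 < a → a ≤ b → A a ≤ A b) :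
    ∃ N : ℝ → ℝ → ℕ,
      ∀ (X : Type) [MetricSpace X] [MeasurableSpace X] [BorelSpace X] (μ : Measure X),
        InteriorDoubling μ A →
        ∀ p ∈ rInterior X r, ∀ R ε : ℝ, 0 < ε →
          ∃ F : Finset X, ↑F ⊆ rInterior X r ∧ F.card ≤ N R ε ∧
            ∀ x ∈ rInterior X r,
              lengthEDistIn (rInterior X r) p x < ENNReal.ofReal R →
              ∃ y ∈ F, dist x y < ε := by
  have hm : ∀ ε : ℝ, ∃ m : ℕ, 1 ≤ m ∧ (0 < ε → 2 * (r / 2 ^ m) ≤ ε) := by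
    intro ε
    by_cases hε : 0 < ε
    · obtain ⟨n, hn⟩ := pow_unbounded_of_one_lt (r / ε) (one_lt_two (α := ℝ))
      refine ⟨n + 1, by omega, fun _ => ?_⟩
      rw [div_lt_iff₀ hε] at hn
      have : 2 * (r / 2 ^ (n + 1)) = r / 2 ^ n := by rw [pow_succ]; field_simp
      rw [this, div_le_iff₀ (by positivity)]
      linarith
    · exact ⟨1, le_rfl, fun h => absurd h hε⟩
  choose m hm1 hm2 using hm
  refine ⟨fun R ε => ⌊(A r) ^ 4⌋₊ ^ ⌈R / (r / 8)⌉₊ * ⌊(A r) ^ (m ε)⌋₊, ?_⟩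
  intro X _ _ _ μ hμ p hp R ε hε
  obtain ⟨G, hG, hGc, hcov⟩ := aux_chain_cover hr hA_mono hμ p hp ⌈R / (r / 8)⌉₊
  obtain ⟨F, hF, hFc, hFcov⟩ := aux_global hr hA_mono hμ (m ε) (hm1 ε)
    (rInterior X r ∩ auxChain (rInterior X r) (r / 8) p ⌈R / (r / 8)⌉₊) G hG (by
      rintro z ⟨hz, hz2⟩
      obtain ⟨x, hx, hwx⟩ := hcov z hz2
      exact ⟨hz, x, hx, by linarith⟩)
  refine ⟨F, hF, hFc.trans (Nat.mul_le_mul_right _ hGc), ?_⟩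
  intro x hx hlen
  obtain ⟨y, hy, hxy⟩ := hFcov x ⟨hx, aux_ball_chain _ _ (by positivity) p hp R x hlen⟩
  exact ⟨y, hy, hxy.trans_le (hm2 ε hε)⟩

/-- Precompactness of `r`-interiors (the paper's Theorem on manifolds with boundary,
metric-measure form).  (a) Intrinsic `R`-balls in the `r`-interior `X_r°`, equipped with
the restricted metric, form a uniformly totally bounded family; (b) consequently,
`r`-interiors of intrinsic diameter `≤ D`, with the restricted metric, form a uniformly
totally bounded family — hence both families are Gromov–Hausdorff precompact. -/
theorem rInterior_uniformly_totallyBounded (r : ℝ) (hr : 0 < r) (A : ℝ → ℝ≥0)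
    (hA_mono : ∀ a b : ℝ, 0 < a → a ≤ b → A a ≤ A b) (hA_one : ∀ a : ℝ, 0 < a → 1 ≤ A a) :
    (∃ N : ℝ → ℝ → ℕ,
      ∀ (X : Type) [MetricSpace X] [MeasurableSpace X] [BorelSpace X] (μ : Measure X),
        IsLengthSpace X → InteriorDoubling μ A →
        ∀ p ∈ rInterior X r, ∀ R ε : ℝ, 0 < R → 0 < ε →
          ∃ F : Finset X, ↑F ⊆ rInterior X r ∧ F.card ≤ N R ε ∧
            ∀ x ∈ rInterior X r,
              lengthEDistIn (rInterior X r) p x < ENNReal.ofReal R →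
              ∃ y ∈ F, dist x y < ε) ∧
    (∀ D : ℝ, 0 < D → ∃ N : ℝ → ℕ,
      ∀ (X : Type) [MetricSpace X] [MeasurableSpace X] [BorelSpace X] (μ : Measure X),
        IsLengthSpace X → InteriorDoubling μ A →
        (∀ x ∈ rInterior X r, ∀ y ∈ rInterior X r,
          lengthEDistIn (rInterior X r) x y ≤ ENNReal.ofReal D) →
        ∀ ε : ℝ, 0 < ε →
          ∃ F : Finset X, ↑F ⊆ rInterior X r ∧ F.card ≤ N ε ∧
            ∀ x ∈ rInterior X r, ∃ y ∈ F, dist x y < ε) := by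
  obtain ⟨N, hN⟩ := aux_main r hr A hA_mono
  refine ⟨⟨N, ?_⟩, ?_⟩
  · intro X _ _ _ μ _ hμ p hp R ε _ hε
    exact hN X μ hμ p hp R ε hε
  · intro D hD
    refine ⟨N (D + 1), ?_⟩
    intro X _ _ _ μ _ hμ hdiam ε hε
    rcases (rInterior X r).eq_empty_or_nonempty with he | ⟨p, hp⟩
    · exact ⟨∅, by simp, by simp, by simp [he]⟩
    · obtain ⟨F, hF, hc, hcov⟩ := hN X μ hμ p hp (D + 1) ε hε
      refine ⟨F, hF, hc, fun x hx => hcov x hx ((hdiam p hp x hx).trans_lt ?_)⟩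
      exact (ENNReal.ofReal_lt_ofReal_iff (by linarith)).2 (by linarith)
end
end
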